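/- Let p be a prime with p ≥ 5 and k an even integer, and let K = Q(√-3). If f ∈ M_k^{(s)}(U_2(O_K), ν_k)_{Z_(p)} satisfies a_f([[m, α],[ᾱ, n]]) ≡ 0 (mod p) for all integers m, n and all α ∈ D_K^{-1} with 0 ≤ m ≤ (5k+9)/45, 0 ≤ n ≤ (10k+3)/90 and mn − N(α) ≥ 0 (where N is the norm), then a_f(H) ≡ 0 (mod p) for every semi-positive definite H ∈ Λ_2(K), i.e. f ≡ 0 (mod p). -/

import Mathlib

open Complex Matrix
open scoped ComplexOrder

noncomputable section

/-- `√d_K` for an imaginary quadratic discriminant `d < 0`,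
taken as `√|d| · i` in the upper half plane. -/
def sqrtD (d : ℤ) : ℂ := Real.sqrt (-d) * Complex.I

/-- The ring of integers `O_K = ℤ[(d + √d)/2]` of the imaginary quadratic field of
discriminant `d`, viewed as a subset of `ℂ`. -/
def ringInt (d : ℤ) : Set ℂ :=
  {z | ∃ a b : ℤ, z = (a : ℂ) + (b : ℂ) * (((d : ℂ) + sqrtD d) / 2)}

/-- The inverse different `D_K⁻¹ = O_K / √d_K`. -/
def invDiff (d : ℤ) : Set ℂ := {z | sqrtD d * z ∈ ringInt d}

/-- The Hermitian upper half-space of degree 2: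
`Z` with `(Z - ᵗZ̄)/(2i)` positive definite. -/
def HermitianUpperHalfSpace : Set (Matrix (Fin 2) (Fin 2) ℂ) :=
  {Z | ((Z - Zᴴ).map (fun w => w / (2 * Complex.I))).PosDef}

/-- The lattice `Λ₂(K)`: Hermitian matrices with integral diagonal and
`√d_K ·`(off-diagonal entries) in `O_K`. -/
def LambdaH (d : ℤ) : Set (Matrix (Fin 2) (Fin 2) ℂ) :=
  {H | H.IsHermitian ∧ (∀ i, ∃ n : ℤ, H i i = (n : ℂ)) ∧
    ∀ i j, sqrtD d * H i j ∈ ringInt d}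

/-- Semi-positive elements of `Λ₂(K)`, the index set of Fourier expansions. -/
def HermLattice (d : ℤ) : Set (Matrix (Fin 2) (Fin 2) ℂ) :=
  {H | H ∈ LambdaH d ∧ H.PosSemidef}

/-- The symplectic-form matrix `J₂ = [[0, -1], [1, 0]]` (2×2 blocks). -/
def J2 : Matrix (Fin 2 ⊕ Fin 2) (Fin 2 ⊕ Fin 2) ℂ :=
  Matrix.fromBlocks 0 (-1) 1 0

/-- The Hermitian modular group `U₂(O_K)`:
matrices with entries in `O_K` satisfying `ᵗM̄ J₂ M = J₂`. -/
def HermitianModularGroup (d : ℤ) : Set (Matrix (Fin 2 ⊕ Fin 2) (Fin 2 ⊕ Fin 2) ℂ) :=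
  {M | (∀ i j, M i j ∈ ringInt d) ∧ Mᴴ * J2 * M = J2}

/-- The fractional-linear action `Z ↦ (AZ + B)(CZ + D)⁻¹`. -/
def matAct (M : Matrix (Fin 2 ⊕ Fin 2) (Fin 2 ⊕ Fin 2) ℂ)
    (Z : Matrix (Fin 2) (Fin 2) ℂ) : Matrix (Fin 2) (Fin 2) ℂ :=
  (M.toBlocks₁₁ * Z + M.toBlocks₁₂) * (M.toBlocks₂₁ * Z + M.toBlocks₂₂)⁻¹

/-- The character `ν_k`: `det^{k/2}` for `K = ℚ(√-1)` (i.e. `d = -4`, `k` even),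
and `det^k` for `K = ℚ(√-3)` (i.e. `d = -3`). -/
def nuChar (d k : ℤ) (M : Matrix (Fin 2 ⊕ Fin 2) (Fin 2 ⊕ Fin 2) ℂ) : ℂ :=
  if d = -4 then M.det ^ (k / 2) else M.det ^ k

/-- A Hermitian modular form of degree 2, weight `k` and character `ν_k` for `U₂(O_K)`,
bundled with its Fourier expansion over the semi-positive part of `Λ₂(K)`. -/
structure HermitianModularForm (d k : ℤ) where
  toFun : Matrix (Fin 2) (Fin 2) ℂ → ℂ
  coeff : Matrix (Fin 2) (Fin 2) ℂ → ℂ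
  holo : DifferentiableOn ℂ (fun Z : Fin 2 → Fin 2 → ℂ => toFun (Matrix.of Z))
    {Z | Matrix.of Z ∈ HermitianUpperHalfSpace}
  transform : ∀ M ∈ HermitianModularGroup d, ∀ Z ∈ HermitianUpperHalfSpace,
    toFun (matAct M Z) =
      nuChar d k M * (M.toBlocks₂₁ * Z + M.toBlocks₂₂).det ^ k * toFun Z
  coeff_supported : ∀ H, coeff H ≠ 0 → H ∈ HermLattice d
  expansion : ∀ Z ∈ HermitianUpperHalfSpace,
    HasSum (fun H : HermLattice d =>
      coeff H * Complex.exp (2 * Real.pi * Complex.I * ((H : Matrix (Fin 2) (Fin 2) ℂ) * Z).trace))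
      (toFun Z)

/-- A Hermitian modular form is symmetric if `f(ᵗZ) = f(Z)`. -/
def IsSymmetricHMF {d k : ℤ} (f : HermitianModularForm d k) : Prop :=
  ∀ Z ∈ HermitianUpperHalfSpace, f.toFun Zᵀ = f.toFun Z

/-- `z` is a `p`-integral rational number: `z = a/b` with `p ∤ b`. -/
def IsPIntegral (p : ℕ) (z : ℂ) : Prop :=
  ∃ a b : ℤ, ¬ (p : ℤ) ∣ b ∧ (b : ℂ) * z = (a : ℂ)

/-- `z ≡ w (mod p^l)` in the local ring `ℤ_(p)`, i.e. `(z - w)/p^l` is `p`-integral. -/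
def ModCongr (p l : ℕ) (z w : ℂ) : Prop :=
  IsPIntegral p ((z - w) / (p : ℂ) ^ l)

/-- The lexicographic order on `Λ₂(K)` used to define `ord_p`:
compare first `tr H`, then the `(1,1)`-entry `m`, then (for off-diagonal entry
`(a + b i)/2`) first `a`, then `b`. -/
def lexLt (H H' : Matrix (Fin 2) (Fin 2) ℂ) : Prop :=
  H.trace.re < H'.trace.re ∨
    (H.trace = H'.trace ∧
      ((H 0 0).re < (H' 0 0).re ∨
        (H 0 0 = H' 0 0 ∧
          ((H 0 1).re < (H' 0 1).re ∨
            ((H 0 1).re = (H' 0 1).re ∧ (H 0 1).im < (H' 0 1).im)))))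

/-- The Siegel upper half-space of degree `n`: symmetric complex matrices with
positive definite imaginary part. -/
def SiegelUpperHalfSpace (n : ℕ) : Set (Matrix (Fin n) (Fin n) ℂ) :=
  {Z | Z.IsSymm ∧ ((Z - Zᴴ).map (fun w => w / (2 * Complex.I))).PosDef}

/-- The symplectic-form matrix over `ℤ` in degree `n`. -/
def Jn (n : ℕ) : Matrix (Fin n ⊕ Fin n) (Fin n ⊕ Fin n) ℤ :=
  Matrix.fromBlocks 0 (-1) 1 0

/-- The Siegel modular group `Γ_n = Sp_n(ℤ)` (as a set of `2n × 2n` integer matrices). -/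
def SiegelModularGroup (n : ℕ) : Set (Matrix (Fin n ⊕ Fin n) (Fin n ⊕ Fin n) ℤ) :=
  {M | Mᵀ * Jn n * M = Jn n}

/-- The fractional-linear action of an integral symplectic matrix on the Siegel
upper half-space. -/
def matActS {n : ℕ} (M : Matrix (Fin n ⊕ Fin n) (Fin n ⊕ Fin n) ℤ)
    (Z : Matrix (Fin n) (Fin n) ℂ) : Matrix (Fin n) (Fin n) ℂ :=
  ((M.map (fun a => (a : ℂ))).toBlocks₁₁ * Z + (M.map (fun a => (a : ℂ))).toBlocks₁₂) *
    ((M.map (fun a => (a : ℂ))).toBlocks₂₁ * Z + (M.map (fun a => (a : ℂ))).toBlocks₂₂)⁻¹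

/-- The index lattice of Fourier expansions of Siegel modular forms of level `N`:
semi-positive symmetric rational matrices `T` with `N·T` half-integral,
i.e. `T ∈ (1/N)Λ_n`. -/
def SiegelLattice (n : ℕ) (N : ℕ) : Set (Matrix (Fin n) (Fin n) ℚ) :=
  {T | T.IsSymm ∧ (∀ i, ∃ a : ℤ, (N : ℚ) * T i i = (a : ℚ)) ∧
    (∀ i j, ∃ a : ℤ, 2 * (N : ℚ) * T i j = (a : ℚ)) ∧
    (T.map (fun q => (q : ℝ))).PosSemidef}

/-- A Siegel modular form of degree `n` and weight `k` for a subgroup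
`Γ ⊆ Γ_n = Sp_n(ℤ)` of level `N`, bundled with its Fourier expansion. For the
full modular group take `Γ = SiegelModularGroup n` and `N = 1`. -/
structure SiegelModularForm (n : ℕ) (k : ℤ)
    (Γ : Set (Matrix (Fin n ⊕ Fin n) (Fin n ⊕ Fin n) ℤ)) (N : ℕ) where
  toFun : Matrix (Fin n) (Fin n) ℂ → ℂ
  coeff : Matrix (Fin n) (Fin n) ℚ → ℂ
  holo : DifferentiableOn ℂ (fun Z : Fin n → Fin n → ℂ => toFun (Matrix.of Z))
    {Z | Matrix.of Z ∈ SiegelUpperHalfSpace n}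
  transform : ∀ M ∈ Γ, ∀ Z ∈ SiegelUpperHalfSpace n,
    toFun (matActS M Z) =
      ((M.map (fun a => (a : ℂ))).toBlocks₂₁ * Z +
        (M.map (fun a => (a : ℂ))).toBlocks₂₂).det ^ k * toFun Z
  coeff_supported : ∀ T, coeff T ≠ 0 → T ∈ SiegelLattice n N
  expansion : ∀ Z ∈ SiegelUpperHalfSpace n,
    HasSum (fun T : SiegelLattice n N =>
      coeff T * Complex.exp (2 * Real.pi * Complex.I *
        (((T : Matrix (Fin n) (Fin n) ℚ).map (fun q => (q : ℂ))) * Z).trace))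
      (toFun Z)

/-- A Hermitian cusp form (degree 2, class number one field): the Fourier
coefficients vanish off the positive definite part of the lattice. -/
def IsCuspHMF {d k : ℤ} (f : HermitianModularForm d k) : Prop :=
  ∀ H, ¬ H.PosDef → f.coeff H = 0

/-- `H0 = ord_p f`: `H0` is the minimal element of `Λ₂(K)`, in the lexicographic
order `lexLt`, whose Fourier coefficient is not divisible by `p`. -/
def IsOrdP (p : ℕ) {d k : ℤ} (f : HermitianModularForm d k)
    (H0 : Matrix (Fin 2) (Fin 2) ℂ) : Prop :=
  H0 ∈ HermLattice d ∧ ¬ ModCongr p 1 (f.coeff H0) 0 ∧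
    ∀ H ∈ HermLattice d, lexLt H H0 → ModCongr p 1 (f.coeff H) 0

section SturmModulo

open UpperHalfPlane ModularForm MatrixGroups
open scoped ArithmeticFunction.sigma

variable {Γ₀ : Type*} [LinearOrderedCommGroupWithZero Γ₀] (v : Valuation ℂ Γ₀)

/-- Products of power series with integral coefficients have integral coefficients. -/
lemma valuation_coeff_mul_le_one {F G : PowerSeries ℂ} (hF : ∀ n, v (F.coeff n) ≤ 1)
    (hG : ∀ n, v (G.coeff n) ≤ 1) (n : ℕ) : v ((F * G).coeff n) ≤ 1 := by
  rw [PowerSeries.coeff_mul]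
  refine v.map_sum_le fun x _ => ?_
  rw [map_mul]
  exact mul_le_one' (hF _) (hG _)

lemma valuation_coeff_pow_le_one {F : PowerSeries ℂ} (hF : ∀ n, v (F.coeff n) ≤ 1) (j : ℕ)
    (n : ℕ) : v ((F ^ j).coeff n) ≤ 1 := by
  induction j generalizing n with
  | zero =>
    rw [pow_zero, PowerSeries.coeff_one]
    split_ifs <;> simp
  | succ j ih => rw [pow_succ]; exact valuation_coeff_mul_le_one v ih hF n

lemma valuation_coeff_mul_lt_one {F G : PowerSeries ℂ} (hF : ∀ n, v (F.coeff n) ≤ 1)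
    (hG : ∀ n, v (G.coeff n) < 1) (n : ℕ) : v ((F * G).coeff n) < 1 := by
  rw [PowerSeries.coeff_mul]
  refine v.map_sum_lt one_ne_zero fun x _ => ?_
  rw [map_mul]
  exact (mul_le_of_le_one_left' (hF _)).trans_lt (hG _)

/-- Dividing by an integral power series of the form `q + O(q²)` preserves divisibility of the
leading coefficients. -/
lemma valuation_coeff_lt_one_of_mul {D G : PowerSeries ℂ} (hD : ∀ n, v (D.coeff n) ≤ 1)
    (hD0 : D.coeff 0 = 0) (hD1 : D.coeff 1 = 1) {d : ℕ}
    (h : ∀ n ≤ d + 1, v ((D * G).coeff n) < 1) : ∀ n ≤ d, v (G.coeff n) < 1 := by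
  intro n
  induction n using Nat.strong_induction_on with
  | _ n ih =>
    intro hn
    have key : (D * G).coeff (n + 1) = G.coeff n +
        ∑ x ∈ (Finset.HasAntidiagonal.antidiagonal n).erase (0, n), D.coeff (x.1 + 1) * G.coeff x.2 := by
      rw [PowerSeries.coeff_mul, Finset.Nat.antidiagonal_succ, Finset.sum_cons, hD0, zero_mul,
        zero_add, Finset.sum_map, ← Finset.add_sum_erase _ _ (a := (0, n)) (by simp)]
      simp [hD1]
    have hG : G.coeff n = (D * G).coeff (n + 1) -
        ∑ x ∈ (Finset.HasAntidiagonal.antidiagonal n).erase (0, n), D.coeff (x.1 + 1) * G.coeff x.2 := by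
      rw [key]; ring
    rw [hG]
    refine v.map_sub_lt (h _ (by omega)) (v.map_sum_lt one_ne_zero fun x hx => ?_)
    rw [map_mul]
    rw [Finset.mem_erase, Finset.HasAntidiagonal.mem_antidiagonal] at hx
    have hlt : x.2 < n := by
      rcases Nat.lt_or_ge x.2 n with h1 | h1
      · exact h1
      · exact absurd (Prod.ext (by simp; omega) (by simp; omega)) hx.1
    exact (mul_le_of_le_one_left' (hD _)).trans_lt (ih _ hlt (by omega))

lemma valuation_natCast_le_one (n : ℕ) : v (n : ℂ) ≤ 1 := by
  induction n with
  | zero => simp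
  | succ n ih =>
    push_cast
    exact (v.map_add _ _).trans (max_le ih (by simp))

lemma valuation_intCast_le_one (n : ℤ) : v (n : ℂ) ≤ 1 := by
  obtain ⟨m, rfl | rfl⟩ := n.eq_nat_or_neg
  · simpa using valuation_natCast_le_one v m
  · simpa [v.map_neg] using valuation_natCast_le_one v m

lemma valuation_coeff_E₄_le_one (n : ℕ) : v ((qExpansion 1 E₄).coeff n) ≤ 1 := by
  have h : (qExpansion 1 E₄).coeff n =
      ((if n = 0 then 1 else 240 * (ArithmeticFunction.sigma 3 n) : ℕ) : ℂ) := by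
    rw [EisensteinSeries.E_qExpansion_coeff _ ⟨2, rfl⟩]
    split_ifs
    · simp
    · norm_num [show bernoulli 4 = -1 / 30 by decide +kernel]
  rw [h]
  exact valuation_natCast_le_one v _

lemma valuation_coeff_E₆_le_one (n : ℕ) : v ((qExpansion 1 E₆).coeff n) ≤ 1 := by
  have h : (qExpansion 1 E₆).coeff n =
      ((if n = 0 then 1 else -504 * (ArithmeticFunction.sigma 5 n) : ℤ) : ℂ) := by
    rw [EisensteinSeries.E_qExpansion_coeff _ ⟨3, rfl⟩]
    split_ifs
    · simp
    · norm_num [show bernoulli 6 = 1 / 42 by decide +kernel]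
  rw [h]
  exact valuation_intCast_le_one v _

lemma qExpansion_discriminant_eq :
    qExpansion 1 ModularForm.discriminant =
      (1 / 1728 : ℂ) • (qExpansion 1 E₄ ^ 3 - qExpansion 1 E₆ ^ 2) := by
  have h : ModularForm.discriminant = ((1 / 1728 : ℂ) •
      (ModularForm.mcast (by decide) (E₄.pow 3) - ModularForm.mcast (by decide) (E₆.pow 2) :
        ModularForm 𝒮ℒ 12) : ModularForm 𝒮ℒ 12) := by
    funext z
    rw [discriminant_eq_E₄_cube_sub_E₆_sq]
    simp only [FunLike.coe_smul, FunLike.coe_sub, coe_mcast, coe_pow, Pi.smul_apply, Pi.sub_apply,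
      Pi.pow_apply, smul_eq_mul]
    ring
  rw [h, FunLike.coe_smul, ModularForm.qExpansion_smul one_pos one_mem_strictPeriods_SL,
    FunLike.coe_sub, ModularForm.qExpansion_sub one_pos one_mem_strictPeriods_SL,
    ModularForm.qExpansion_mcast, ModularForm.qExpansion_mcast,
    ModularForm.qExpansion_pow one_pos one_mem_strictPeriods_SL,
    ModularForm.qExpansion_pow one_pos one_mem_strictPeriods_SL]

lemma valuation_coeff_discriminant_le_one (h6 : v 1728 = 1) (n : ℕ) :
    v ((qExpansion 1 ModularForm.discriminant).coeff n) ≤ 1 := by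
  rw [qExpansion_discriminant_eq, PowerSeries.coeff_smul, smul_eq_mul, map_mul, map_div₀, h6,
    map_one, div_one, one_mul, map_sub]
  exact v.map_sub_le (valuation_coeff_pow_le_one v (valuation_coeff_E₄_le_one v) _ _)
    (valuation_coeff_pow_le_one v (valuation_coeff_E₆_le_one v) _ _)

/-- A Sturm bound with respect to a valuation away from `6` for modular forms of level one. -/
theorem sturm_bound_levelOne_valuation (h6 : v 1728 = 1) (d : ℕ)
    {w : ℤ} (hw : w = 12 * d) (f : ModularForm 𝒮ℒ w)
    (h : ∀ n ≤ d, v ((qExpansion 1 f).coeff n) < 1) (n : ℕ) :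
    v ((qExpansion 1 f).coeff n) < 1 := by
  induction d generalizing w n with
  | zero =>
    obtain rfl : w = 0 := by simpa using hw
    obtain ⟨c, hc⟩ := ModularFormClass.levelOne_weight_zero_const f
    have hq : qExpansion 1 f = c • 1 := by
      have : (f : ℍ → ℂ) = c • ((1 : ModularForm 𝒮ℒ 0) : ℍ → ℂ) := by
        rw [hc]; funext z; simp
      rw [this, ModularForm.qExpansion_smul one_pos one_mem_strictPeriods_SL,
        ModularForm.qExpansion_one]
    have h0 := h 0 le_rfl
    rw [hq] at h0 ⊢
    rcases n with _ | n
    · exact h0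
    · simp [PowerSeries.coeff_one]
  | succ d ih =>
    let g : ModularForm 𝒮ℒ w := ModularForm.mcast (by rw [hw]; push_cast; ring) (E₄.pow (3 * (d + 1)))
    have hg : qExpansion 1 g = qExpansion 1 E₄ ^ (3 * (d + 1)) := by
      rw [ModularForm.qExpansion_mcast, ModularForm.qExpansion_pow one_pos one_mem_strictPeriods_SL]
    set c := (qExpansion 1 f).coeff 0 with hc
    have hcv : v c < 1 := h 0 (by omega)
    let F : ModularForm 𝒮ℒ w := f - c • g
    have hF : qExpansion 1 F = qExpansion 1 f - c • qExpansion 1 E₄ ^ (3 * (d + 1)) := by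
      rw [FunLike.coe_sub, ModularForm.qExpansion_sub one_pos one_mem_strictPeriods_SL,
        FunLike.coe_smul, ModularForm.qExpansion_smul one_pos one_mem_strictPeriods_SL, hg]
    have hE0 : PowerSeries.constantCoeff (qExpansion 1 E₄) = 1 := by
      simpa using EisensteinSeries.E_qExpansion_coeff_zero (k := 4) (by norm_num) ⟨2, rfl⟩
    have hF0 : (qExpansion 1 F).coeff 0 = 0 := by
      rw [hF, map_sub, PowerSeries.coeff_smul, PowerSeries.coeff_zero_eq_constantCoeff, map_pow,
        hE0, ← PowerSeries.coeff_zero_eq_constantCoeff, ← hc]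
      simp
    have hcE : ∀ n, v ((c • qExpansion 1 E₄ ^ (3 * (d + 1))).coeff n) < 1 := fun n => by
      rw [PowerSeries.coeff_smul, smul_eq_mul, map_mul]
      exact (mul_le_of_le_one_right'
        (valuation_coeff_pow_le_one v (valuation_coeff_E₄_le_one v) _ _)).trans_lt hcv
    have hmul := qExpansion_eq_qExpansion_discriminant_mul F hF0
    have hD := valuation_coeff_discriminant_le_one v h6
    have hD0 : (qExpansion 1 ModularForm.discriminant).coeff 0 = 0 := by
      simpa using CuspFormClass.qExpansion_coeff_zero CuspForm.discriminant one_pos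
          one_mem_strictPeriods_SL
    have hlow : ∀ n ≤ d + 1, v ((qExpansion 1 F).coeff n) < 1 := fun n hn => by
      rw [hF, map_sub]
      exact v.map_sub_lt (h n hn) (hcE n)
    rw [hmul] at hlow
    have hG := ih (w := w - 12) (by rw [hw]; push_cast; ring)
      (CuspForm.discriminantEquiv (toCuspForm F hF0))
      (valuation_coeff_lt_one_of_mul v hD hD0 discriminant_qExpansion_coeff_one hlow)
    have hFv := valuation_coeff_mul_lt_one v hD hG n
    rw [← hmul, hF, map_sub] at hFv
    rw [← sub_add_cancel ((qExpansion 1 f).coeff n) ((c • qExpansion 1 E₄ ^ (3 * (d + 1))).coeff n)]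
    exact v.map_add_lt hFv (hcE n)

/-- Version of the Sturm bound allowing negative weights. -/
theorem sturm_bound_levelOne_valuation_int (h6 : v 1728 = 1) (d : ℤ)
    {w : ℤ} (hw : w = 12 * d) (f : ModularForm 𝒮ℒ w)
    (h : ∀ n : ℕ, (n : ℤ) ≤ d → v ((qExpansion 1 f).coeff n) < 1) (n : ℕ) :
    v ((qExpansion 1 f).coeff n) < 1 := by
  rcases lt_or_ge d 0 with hd | hd
  · have : (f : ℍ → ℂ) = 0 := ModularFormClass.levelOne_neg_weight_eq_zero (by omega) f
    rw [this, qExpansion_zero]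
    simp
  · lift d to ℕ using hd
    exact sturm_bound_levelOne_valuation v h6 d hw f (fun n hn => h n (mod_cast hn)) n

end SturmModulo

section QSeries

open UpperHalfPlane ModularForm MatrixGroups Function.Periodic
open scoped Manifold

/-- `B` is a `q`-expansion of width `N` of the function `g` on the upper half plane. -/
def HasQSeries (N : ℕ) (g : ℍ → ℂ) (B : PowerSeries ℂ) : Prop :=
  ∀ τ : ℍ, HasSum (fun j : ℕ => B.coeff j * qParam N τ ^ j) (g τ)

lemma HasQSeries.one (N : ℕ) : HasQSeries N 1 1 := fun τ => by
  convert hasSum_ite_eq 0 (1 : ℂ) using 2 with j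
  on_goal 2 => rfl
  rw [PowerSeries.coeff_one]
  split_ifs with h <;> simp [h]

lemma HasQSeries.mul {N : ℕ} {g h : ℍ → ℂ} {B C : PowerSeries ℂ} (hg : HasQSeries N g B)
    (hh : HasQSeries N h C) : HasQSeries N (g * h) (B * C) := fun τ => by
  have hB := (hg τ).summable.norm
  have hC := (hh τ).summable.norm
  have key : (fun j : ℕ => (B * C).coeff j * qParam N τ ^ j) = fun n =>
      ∑ kl ∈ Finset.HasAntidiagonal.antidiagonal n, (B.coeff kl.1 * qParam N τ ^ kl.1) *
        (C.coeff kl.2 * qParam N τ ^ kl.2) := by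
    funext n
    rw [PowerSeries.coeff_mul, Finset.sum_mul]
    refine Finset.sum_congr rfl fun x hx => ?_
    rw [← Finset.HasAntidiagonal.mem_antidiagonal.mp hx]
    ring
  rw [key, Pi.mul_apply, ← (hg τ).tsum_eq, ← (hh τ).tsum_eq,
    tsum_mul_tsum_eq_tsum_sum_antidiagonal_of_summable_norm hB hC]
  exact (summable_norm_sum_mul_antidiagonal_of_summable_norm hB hC).of_norm.hasSum

lemma HasQSeries.pow {N : ℕ} {g : ℍ → ℂ} {B : PowerSeries ℂ} (hg : HasQSeries N g B) (n : ℕ) :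
    HasQSeries N (g ^ n) (B ^ n) := by
  induction n with
  | zero => simpa using HasQSeries.one N
  | succ n ih => rw [pow_succ, pow_succ]; exact ih.mul hg

lemma HasQSeries.prod {ι : Type*} {N : ℕ} {g : ι → ℍ → ℂ} {B : ι → PowerSeries ℂ} (s : Finset ι)
    (hg : ∀ i ∈ s, HasQSeries N (g i) (B i)) :
    HasQSeries N (∏ i ∈ s, g i) (∏ i ∈ s, B i) := by
  classical
  induction s using Finset.induction_on with
  | empty => simpa using HasQSeries.one N
  | insert i s hi ih =>
    rw [Finset.prod_insert hi, Finset.prod_insert hi]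
    exact (hg i (by simp)).mul (ih fun j hj => hg j (by simp [hj]))

lemma norm_qParam_eq_exp (N : ℕ) (τ : ℂ) :
    ‖qParam N τ‖ = Real.exp (-2 * Real.pi * τ.im / N) := by
  simpa using norm_qParam (N : ℝ) τ

lemma HasQSeries.mdifferentiable {N : ℕ} {g : ℍ → ℂ} {B : PowerSeries ℂ}
    (hg : HasQSeries N g B) : MDiff g := by
  rw [UpperHalfPlane.mdifferentiable_iff]
  intro z hz
  have hz' : 0 < z.im := hz
  let s : Set ℂ := {w | z.im / 2 < w.im}
  have hs : IsOpen s := isOpen_lt continuous_const Complex.continuous_im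
  have hzs : z ∈ s := by change z.im / 2 < z.im; linarith
  have hsum := (hg ⟨⟨0, z.im / 2⟩, by change 0 < z.im / 2; linarith⟩).summable.norm
  have hd : DifferentiableOn ℂ (fun w => ∑' j : ℕ, B.coeff j * qParam N w ^ j) s := by
    refine differentiableOn_tsum_of_summable_norm hsum (fun j => ?_) hs fun j w hw => ?_
    · refine Differentiable.differentiableOn ?_
      unfold qParam
      fun_prop
    · rw [norm_mul, norm_mul, norm_pow, norm_pow, norm_qParam_eq_exp, norm_qParam_eq_exp]
      have hw' : z.im / 2 ≤ w.im := le_of_lt hw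
      have : 0 ≤ Real.pi := Real.pi_pos.le
      gcongr ?_ * ?_ ^ j
      apply Real.exp_le_exp.mpr
      gcongr ?_ / _
      change -2 * Real.pi * w.im ≤ -2 * Real.pi * (z.im / 2)
      nlinarith
  refine ((hd z hzs).differentiableAt (hs.mem_nhds hzs)).differentiableWithinAt.congr_of_eventuallyEq
    ?_ ?_
  · filter_upwards [self_mem_nhdsWithin] with w hw
    rw [Function.comp_apply, ofComplex_apply_of_im_pos hw]
    exact (hg ⟨w, hw⟩).tsum_eq.symm
  · rw [Function.comp_apply, ofComplex_apply_of_im_pos hz']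
    exact (hg ⟨z, hz'⟩).tsum_eq.symm

/-- A function with a `q`-expansion and the transformation behaviour of a level one form
under the standard generators is a level one modular form. -/
lemma HasQSeries.exists_modularForm {N : ℕ} (hN : 0 < N) {g : ℍ → ℂ} {B : PowerSeries ℂ}
    (hg : HasQSeries N g B) {w : ℤ} (hT : ∀ τ : ℍ, g ((1 : ℝ) +ᵥ τ) = g τ)
    (hS : ∀ τ : ℍ, g (ModularGroup.S • τ) = (τ : ℂ) ^ w * g τ) :
    ∃ f : ModularForm 𝒮ℒ w, (f : ℍ → ℂ) = g := by
  have hS' : g ∣[w] ModularGroup.S = g := by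
    funext τ
    rw [SL_slash_apply, hS, ModularGroup.denom_S, mul_right_comm, ← zpow_add₀ τ.ne_zero]
    simp
  have hT' : g ∣[w] ModularGroup.T = g := by
    funext τ
    rw [SL_slash_apply, modular_T_smul, hT, ModularGroup.denom_apply]
    simp [ModularGroup.T]
  refine ⟨{ toFun := g
            slash_action_eq' := ?_
            holo' := hg.mdifferentiable
            bdd_at_cusps' := ?_ }, rfl⟩
  · rintro A ⟨A, rfl⟩
    exact SlashInvariantForm.slash_action_generators_SL2Z hS' hT' A
  · intro c hc
    rw [Subgroup.IsArithmetic.isCusp_iff_isCusp_SL2Z] at hc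
    rw [OnePoint.isBoundedAt_iff_forall_SL2Z hc]
    intro γ _
    rw [SlashInvariantForm.slash_action_generators_SL2Z hS' hT']
    exact isBoundedAtImInfty_of_hasSum_qExpansion (h := N) (by exact_mod_cast hN)
      hg

lemma HasQSeries.unique {N : ℕ} (hN : 0 < N) {g : ℍ → ℂ} {B C : PowerSeries ℂ}
    (hT : ∀ τ : ℍ, g ((N : ℝ) +ᵥ τ) = g τ)
    (hB : HasQSeries N g B) (hC : HasQSeries N g C) : B = C := by
  have hN' : (0 : ℝ) < N := by exact_mod_cast hN
  have hper : Function.Periodic (g ∘ ofComplex) (N : ℝ) := fun z => by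
    rcases lt_or_ge 0 z.im with hz | hz
    · rw [Function.comp_apply, Function.comp_apply, ofComplex_apply_of_im_pos hz,
        ofComplex_apply_of_im_pos (by simpa using hz), ← hT ⟨z, hz⟩]
      congr 1
      ext
      simp [add_comm]
    · rw [Function.comp_apply, Function.comp_apply, ofComplex_apply_of_im_nonpos hz,
        ofComplex_apply_of_im_nonpos (by simpa using hz)]
  have han := analyticAt_cuspFunction_zero hN' hper hB.mdifferentiable
    (isBoundedAtImInfty_of_hasSum_qExpansion (c := fun j => B.coeff j) hN' hB)
  have heq := FormalMultilinearSeries.ofScalars_series_injective ℂ ℂ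
    ((hasFPowerSeriesOnBall_cuspFunction hN' han hB).hasFPowerSeriesAt.eq_formalMultilinearSeries
      (hasFPowerSeriesOnBall_cuspFunction hN' han hC).hasFPowerSeriesAt)
  ext m
  exact congrFun heq m

/-- The `q`-expansion of width `N` of a level one form is its usual one in `q ^ N`. -/
lemma HasQSeries.coeff_modularForm {N : ℕ} (hN : 0 < N) {w : ℤ} (f : ModularForm 𝒮ℒ w)
    {B : PowerSeries ℂ} (hB : HasQSeries N f B) (m : ℕ) :
    B.coeff m = if N ∣ m then (qExpansion 1 f).coeff (m / N) else 0 := by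
  have hC : HasQSeries N f
      (PowerSeries.mk fun m => if N ∣ m then (qExpansion 1 f).coeff (m / N) else 0) := fun τ => by
    have h := ModularForm.hasSum_qExpansion (f := f) one_pos one_mem_strictPeriods_SL τ
    have hinj : Function.Injective (fun j : ℕ => N * j) := fun a b hab =>
      Nat.eq_of_mul_eq_mul_left hN hab
    rw [← hinj.hasSum_iff]
    · convert h using 2 with j
      simp only [Function.comp_apply, PowerSeries.coeff_mk, dvd_mul_right, if_true,
        Nat.mul_div_cancel_left j hN, pow_mul]
      congr 2
      unfold qParam
      rw [← Complex.exp_nat_mul]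
      congr 1
      have : (N : ℂ) ≠ 0 := by exact_mod_cast hN.ne'
      simp
      field_simp
    · intro m hm
      rw [PowerSeries.coeff_mk, if_neg, zero_mul]
      rintro ⟨j, rfl⟩
      exact hm ⟨j, rfl⟩
  have hT1 : ∀ τ : ℍ, f ((1 : ℝ) +ᵥ τ) = f τ := fun τ =>
    SlashInvariantForm.vAdd_apply_of_mem_strictPeriods f τ one_mem_strictPeriods_SL
  have hTn : ∀ (n : ℕ) (τ : ℍ), f ((n : ℝ) +ᵥ τ) = f τ := fun n => by
    induction n with
    | zero => simp
    | succ n ih => intro τ; rw [Nat.cast_succ, add_vadd, ih, hT1]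
  rw [hB.unique hN (hTn N) hC, PowerSeries.coeff_mk]

end QSeries

section ValuationOrder

open UpperHalfPlane ModularForm MatrixGroups

variable {Γ₀ : Type*} [LinearOrderedCommGroupWithZero Γ₀] (v : Valuation ℂ Γ₀)

/-- `F` is integral and `o` is the index of its first coefficient which is a unit. -/
structure HasValOrder (F : PowerSeries ℂ) (o : ℕ) : Prop where
  le_one : ∀ n, v (F.coeff n) ≤ 1
  lt_one : ∀ n < o, v (F.coeff n) < 1
  eq_one : v (F.coeff o) = 1

variable {v}

lemma HasValOrder.one : HasValOrder v 1 0 where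
  le_one n := by rw [PowerSeries.coeff_one]; split_ifs <;> simp
  lt_one n hn := by omega
  eq_one := by simp

lemma HasValOrder.mul {F G : PowerSeries ℂ} {a b : ℕ} (hF : HasValOrder v F a)
    (hG : HasValOrder v G b) : HasValOrder v (F * G) (a + b) where
  le_one := valuation_coeff_mul_le_one v hF.le_one hG.le_one
  lt_one n hn := by
    rw [PowerSeries.coeff_mul]
    refine v.map_sum_lt one_ne_zero fun x hx => ?_
    rw [Finset.HasAntidiagonal.mem_antidiagonal] at hx
    rw [map_mul]
    rcases lt_or_ge x.1 a with h | h
    · exact (mul_le_of_le_one_right' (hG.le_one _)).trans_lt (hF.lt_one _ h)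
    · exact (mul_le_of_le_one_left' (hF.le_one _)).trans_lt (hG.lt_one _ (by omega))
  eq_one := by
    rw [PowerSeries.coeff_mul, ← Finset.add_sum_erase _ _ (a := (a, b)) (by simp)]
    have h1 : v (F.coeff a * G.coeff b) = 1 := by rw [map_mul, hF.eq_one, hG.eq_one, one_mul]
    rw [v.map_add_eq_of_lt_left, h1]
    rw [h1]
    refine v.map_sum_lt one_ne_zero fun x hx => ?_
    rw [Finset.mem_erase, Finset.HasAntidiagonal.mem_antidiagonal] at hx
    rw [map_mul]
    rcases lt_or_ge x.1 a with h | h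
    · exact (mul_le_of_le_one_right' (hG.le_one _)).trans_lt (hF.lt_one _ h)
    · refine (mul_le_of_le_one_left' (hF.le_one _)).trans_lt (hG.lt_one _ ?_)
      by_contra hb
      exact hx.1 (Prod.ext (by simp; omega) (by simp; omega))

lemma HasValOrder.pow {F : PowerSeries ℂ} {a : ℕ} (hF : HasValOrder v F a) (n : ℕ) :
    HasValOrder v (F ^ n) (n * a) := by
  induction n with
  | zero => simpa using HasValOrder.one
  | succ n ih => rw [pow_succ, add_one_mul]; exact ih.mul hF

lemma HasValOrder.prod {ι : Type*} {F : ι → PowerSeries ℂ} {a : ι → ℕ} (s : Finset ι)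
    (hF : ∀ i ∈ s, HasValOrder v (F i) (a i)) :
    HasValOrder v (∏ i ∈ s, F i) (∑ i ∈ s, a i) := by
  classical
  induction s using Finset.induction_on with
  | empty => simpa using HasValOrder.one
  | insert i s hi ih =>
    rw [Finset.prod_insert hi, Finset.sum_insert hi]
    exact (hF i (by simp)).mul (ih fun j hj => hF j (by simp [hj]))

/-- The vanishing order modulo the maximal ideal of a level one form is at most a twelfth of
the weight. -/
lemma HasValOrder.le_of_modularForm (h6 : v 1728 = 1) {N : ℕ} (hN : 0 < N) {D w : ℤ}
    (hw : w = 12 * D) (f : ModularForm 𝒮ℒ w) {B : PowerSeries ℂ} (hB : HasQSeries N f B) {o : ℕ}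
    (ho : HasValOrder v B o) : (o : ℤ) ≤ N * D := by
  have hc := hB.coeff_modularForm hN f
  have hdvd : N ∣ o := by
    by_contra h
    have := ho.eq_one
    rw [hc, if_neg h, map_zero] at this
    exact zero_ne_one this
  obtain ⟨t, rfl⟩ := hdvd
  have hco (j : ℕ) : B.coeff (N * j) = (qExpansion 1 f).coeff j := by
    rw [hc, if_pos (dvd_mul_right _ _), Nat.mul_div_cancel_left _ hN]
  by_contra! hlt
  have hDt : D < t := by
    push_cast at hlt
    exact lt_of_mul_lt_mul_left hlt (by positivity)
  have := sturm_bound_levelOne_valuation_int v h6 D hw f (fun n hn => by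
    rw [← hco]
    exact ho.lt_one _ (Nat.mul_lt_mul_of_pos_left (by omega) hN)) t
  rw [← hco, ho.eq_one] at this
  exact lt_irrefl _ this

end ValuationOrder

section FiberSums

/-- Grouping the terms of an exponential-type sum according to their exponent. -/
lemma HasSum.group_exponents {ι : Type*} {J : ι → ℕ} {a : ι → ℂ} {q s : ℂ}
    (hfin : ∀ j, {i | J i = j ∧ a i ≠ 0}.Finite) (h : HasSum (fun i => a i * q ^ J i) s) :
    HasSum (fun j => (∑ i ∈ (hfin j).toFinset, a i) * q ^ j) s := by
  rw [← (Equiv.sigmaFiberEquiv J).hasSum_iff] at h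
  refine h.sigma fun j => ?_
  have h0 : HasSum (a ∘ ((↑) : {i | J i = j} → ι)) (∑ i ∈ (hfin j).toFinset, a i) := by
    rw [hasSum_subtype_iff_indicator]
    have h1 : ∑ i ∈ (hfin j).toFinset, a i =
        ∑ i ∈ (hfin j).toFinset, Set.indicator {i | J i = j} a i :=
      Finset.sum_congr rfl fun i hi =>
        (Set.indicator_of_mem (s := {i | J i = j}) ((hfin j).mem_toFinset.mp hi).1 a).symm
    rw [h1]
    refine hasSum_sum_of_ne_finset_zero fun i hi => ?_
    by_contra hne
    exact hi ((hfin j).mem_toFinset.mpr (Set.indicator_apply_ne_zero.mp hne))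
  have h2 : (fun i : {i // J i = j} => ((fun i => a i * q ^ J i) ∘ Equiv.sigmaFiberEquiv J) ⟨j, i⟩) =
      fun i : {i // J i = j} => a i * q ^ j := by
    funext i
    simp [Equiv.sigmaFiberEquiv, i.2]
  rw [h2]
  exact h0.mul_right (q ^ j)

end FiberSums

section RootsOfUnity

variable (A : ValuationSubring ℂ)

lemma residue_eq_zero_iff_valuation (x : A) :
    IsLocalRing.residue A x = 0 ↔ A.valuation (x : ℂ) < 1 := by
  rw [IsLocalRing.residue_eq_zero_iff, ValuationSubring.valuation_lt_one_iff]

lemma valuation_eq_one_of_pow_eq_one {Γ₀ : Type*} [LinearOrderedCommGroupWithZero Γ₀]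
    (v : Valuation ℂ Γ₀) {ζ : ℂ} {n : ℕ} (hn : n ≠ 0) (h : ζ ^ n = 1) : v ζ = 1 := by
  have h1 : v ζ ^ n = 1 := by rw [← map_pow, h, map_one]
  exact (pow_eq_one_iff.mp h1).resolve_right hn

lemma orderOf_residue_primitiveRoot {ℓ : ℕ} (hℓ : ℓ.Prime) (hv : A.valuation (ℓ : ℂ) = 1)
    {ζ : A} (hζ : IsPrimitiveRoot (ζ : ℂ) ℓ) : orderOf (IsLocalRing.residue A ζ) = ℓ := by
  have := Fact.mk hℓ
  have hpow : ζ ^ ℓ = 1 := Subtype.ext (by simpa using hζ.pow_eq_one)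
  refine orderOf_eq_prime (by rw [← map_pow, hpow, map_one]) fun h1 => ?_
  have hsum : ∑ i ∈ Finset.range ℓ, ζ ^ i = 0 :=
    Subtype.ext (by simpa using hζ.geom_sum_eq_zero hℓ.one_lt)
  have h2 := congrArg (IsLocalRing.residue A) hsum
  rw [map_sum, map_zero] at h2
  simp only [map_pow, h1, one_pow, Finset.sum_const, Finset.card_range, nsmul_eq_mul,
    mul_one] at h2
  rw [← map_natCast (IsLocalRing.residue A), residue_eq_zero_iff_valuation] at h2
  have h3 : A.valuation (ℓ : ℂ) < 1 := by simpa using h2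
  exact h3.ne hv

/-- A Laurent polynomial which is nonzero in the residue field takes unit values at roots of
unity of large prime order. -/
lemma exists_valuation_laurent_eq_one (s : Finset ℤ) (c : ℤ → ℂ)
    (hc : ∀ r, A.valuation (c r) ≤ 1) {r₀ : ℤ} (hr₀ : r₀ ∈ s) (h₀ : A.valuation (c r₀) = 1) :
    ∃ L : ℕ, ∀ ℓ : ℕ, ℓ.Prime → L ≤ ℓ → A.valuation (ℓ : ℂ) = 1 → ∀ ζ : ℂ, IsPrimitiveRoot ζ ℓ →
      A.valuation (∑ r ∈ s, c r * ζ ^ r) = 1 := by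
  classical
  let c' : ℤ → A := fun r => ⟨c r, (A.valuation_le_one_iff _).mp (hc r)⟩
  let T : ℕ := ∑ r ∈ s, r.natAbs
  have hT : ∀ r ∈ s, 0 ≤ r + T := fun r hr => by
    have : r.natAbs ≤ T := Finset.single_le_sum (f := fun r : ℤ => r.natAbs) (by simp) hr
    omega
  let P : Polynomial (IsLocalRing.ResidueField A) :=
    ∑ r ∈ s, Polynomial.monomial (r + T).toNat (IsLocalRing.residue A (c' r))
  have hP : P ≠ 0 := by
    intro h
    have h1 : P.coeff (r₀ + T).toNat = IsLocalRing.residue A (c' r₀) := by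
      rw [Polynomial.finsetSum_coeff, Finset.sum_eq_single r₀]
      · simp
      · intro r hr hne
        rw [Polynomial.coeff_monomial, if_neg]
        have := hT r hr
        have := hT r₀ hr₀
        omega
      · exact fun h => absurd hr₀ h
    rw [h, Polynomial.coeff_zero, eq_comm, residue_eq_zero_iff_valuation] at h1
    exact h1.ne h₀
  refine ⟨∑ x ∈ P.roots.toFinset, orderOf x + 1, fun ℓ hℓ hL hv ζ hζ => ?_⟩
  have hvζ : A.valuation ζ = 1 := valuation_eq_one_of_pow_eq_one _ hℓ.ne_zero hζ.pow_eq_one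
  let ζ' : A := ⟨ζ, (A.valuation_le_one_iff _).mp hvζ.le⟩
  have hle : A.valuation (∑ r ∈ s, c r * ζ ^ r) ≤ 1 :=
    A.valuation.map_sum_le fun r _ => by rw [map_mul, map_zpow₀, hvζ, _root_.one_zpow, mul_one]; exact hc r
  refine hle.eq_of_not_lt fun hlt => ?_
  have hz : P.eval (IsLocalRing.residue A ζ') = 0 := by
    have h1 : P.eval (IsLocalRing.residue A ζ') =
        IsLocalRing.residue A (∑ r ∈ s, c' r * ζ' ^ (r + T).toNat) := by
      simp [P, Polynomial.eval_finsetSum]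
    have h2 : ((∑ r ∈ s, c' r * ζ' ^ (r + T).toNat : A) : ℂ) =
        ζ ^ T * ∑ r ∈ s, c r * ζ ^ r := by
      push_cast
      rw [Finset.mul_sum]
      refine Finset.sum_congr rfl fun r hr => ?_
      change c r * ζ ^ (r + T).toNat = _
      rw [← zpow_natCast, Int.toNat_of_nonneg (hT r hr), zpow_add₀ (hζ.ne_zero hℓ.ne_zero),
        zpow_natCast]
      ring
    rw [h1, residue_eq_zero_iff_valuation, h2, map_mul, map_pow, hvζ, one_pow, one_mul]
    exact hlt
  have hmem : IsLocalRing.residue A ζ' ∈ P.roots.toFinset := by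
    rw [Multiset.mem_toFinset, Polynomial.mem_roots hP]
    exact hz
  have := Finset.single_le_sum (f := fun x => orderOf x) (fun _ _ => Nat.zero_le _) hmem
  have hord := orderOf_residue_primitiveRoot A hℓ hv (ζ := ζ') hζ
  omega

end RootsOfUnity

section JacobiForms

open UpperHalfPlane ModularForm MatrixGroups Function.Periodic

/-- The normalised exponential `z ↦ e^{2πiz}`. -/
def expTwoPi (z : ℂ) : ℂ := cexp (2 * Real.pi * Complex.I * z)

lemma expTwoPi_add (z w : ℂ) : expTwoPi (z + w) = expTwoPi z * expTwoPi w := by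
  rw [expTwoPi, mul_add, Complex.exp_add]; rfl

lemma expTwoPi_int (n : ℤ) : expTwoPi n = 1 := by
  rw [expTwoPi, mul_comm]; exact Complex.exp_int_mul_two_pi_mul_I n

lemma expTwoPi_ne_zero (z : ℂ) : expTwoPi z ≠ 0 := Complex.exp_ne_zero _

lemma expTwoPi_nat_mul (n : ℕ) (z : ℂ) : expTwoPi (n * z) = expTwoPi z ^ n := by
  rw [expTwoPi, expTwoPi, ← Complex.exp_nat_mul]; ring_nf

lemma expTwoPi_int_mul (n : ℤ) (z : ℂ) : expTwoPi (n * z) = expTwoPi z ^ n := by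
  rw [expTwoPi, expTwoPi, ← Complex.exp_int_mul]; ring_nf

lemma HasSum.of_term_eq {ι : Type*} {f g : ι → ℂ} {s : ℂ} (h : HasSum g s)
    (hfg : ∀ i, f i = g i) : HasSum f s := by
  rwa [funext hfg]

/-- A holomorphic function on `ℍ × ℂ`, given by a Fourier expansion with coefficients `c`,
transforming like a Jacobi form of weight `k` and index `M`. -/
structure IsJacobiForm (k M : ℤ) (c : ℤ × ℤ → ℂ) (φ : ℍ → ℂ → ℂ) : Prop where
  index_nonneg : 0 ≤ M
  support : ∀ p, c p ≠ 0 → 0 ≤ p.1 ∧ p.2 ^ 2 ≤ 4 * M * p.1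
  expansion : ∀ (τ : ℍ) (z : ℂ), HasSum (fun p : ℤ × ℤ => c p * expTwoPi (p.1 * τ + p.2 * z)) (φ τ z)
  inversion : ∀ (τ : ℍ) (z : ℂ),
    φ (ModularGroup.S • τ) (z / τ) = (τ : ℂ) ^ k * expTwoPi (M * z ^ 2 / τ) * φ τ z
  elliptic : ∀ (τ : ℍ) (z : ℂ) (a b : ℤ),
    φ τ (z + a * τ + b) = expTwoPi (-M * (a ^ 2 * τ + 2 * a * z)) * φ τ z

/-- The normalised value of a Jacobi form at the torsion point `(a τ + b) / ℓ`. -/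
def torsionValue (M : ℤ) (φ : ℍ → ℂ → ℂ) (ℓ : ℕ) (a b : ℤ) (τ : ℍ) : ℂ :=
  expTwoPi (M * ((a / ℓ : ℂ) ^ 2 * τ + (a / ℓ : ℂ) * (b / ℓ : ℂ))) *
    φ τ ((a / ℓ : ℂ) * τ + (b / ℓ : ℂ))

/-- The exponent of `q ^ (1 / ℓ²)` contributed by the Fourier index `p` at a torsion point. -/
def torsionExponent (M : ℤ) (ℓ : ℕ) (a : ℤ) (p : ℤ × ℤ) : ℤ :=
  ℓ ^ 2 * p.1 + ℓ * p.2 * a + M * a ^ 2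

/-- The coefficient contributed by the Fourier index `p` at a torsion point. -/
def torsionCoeff (M : ℤ) (c : ℤ × ℤ → ℂ) (ℓ : ℕ) (a b : ℤ) (p : ℤ × ℤ) : ℂ :=
  c p * expTwoPi (p.2 * (b / ℓ : ℂ) + M * ((a / ℓ : ℂ) * (b / ℓ : ℂ)))

variable {k M : ℤ} {c : ℤ × ℤ → ℂ} {φ : ℍ → ℂ → ℂ}

namespace IsJacobiForm

lemma apply_vadd_one (h : IsJacobiForm k M c φ) (τ : ℍ) (z : ℂ) :
    φ ((1 : ℝ) +ᵥ τ) z = φ τ z := by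
  refine (h.expansion _ z).unique ?_
  convert h.expansion τ z using 2 with p
  rw [coe_vadd, show (p.1 : ℂ) * (((1 : ℝ) : ℂ) + τ) + p.2 * z = (p.1 * τ + p.2 * z) + p.1 by
    push_cast; ring, expTwoPi_add _ (p.1 : ℂ), expTwoPi_int, mul_one]

lemma torsionValue_vadd_one (h : IsJacobiForm k M c φ) (ℓ : ℕ) (a b : ℤ) (τ : ℍ) :
    torsionValue M φ ℓ a b ((1 : ℝ) +ᵥ τ) = torsionValue M φ ℓ a (a + b) τ := by
  rw [torsionValue, torsionValue, h.apply_vadd_one, coe_vadd]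
  push_cast
  congr 2 <;> ring

lemma torsionValue_S_smul (h : IsJacobiForm k M c φ) (ℓ : ℕ) (a b : ℤ) (τ : ℍ) :
    torsionValue M φ ℓ a b (ModularGroup.S • τ) =
      (τ : ℂ) ^ k * torsionValue M φ ℓ b (-a) τ := by
  have hS : ((ModularGroup.S • τ : ℍ) : ℂ) = -1 / τ := by
    rw [modular_S_smul]; simp [neg_div]
  have hτ := τ.ne_zero
  rw [torsionValue, torsionValue, hS,
    show (a / ℓ : ℂ) * (-1 / τ) + b / ℓ = ((b / ℓ : ℂ) * τ + ((-a : ℤ) : ℂ) / ℓ) / τ by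
      push_cast; field_simp; ring, h.inversion]
  rw [show (M * ((b / ℓ : ℂ) ^ 2 * τ + (b / ℓ : ℂ) * (((-a : ℤ) : ℂ) / ℓ)) : ℂ) =
    M * ((a / ℓ : ℂ) ^ 2 * (-1 / τ) + (a / ℓ : ℂ) * (b / ℓ : ℂ)) +
      M * ((b / ℓ : ℂ) * τ + ((-a : ℤ) : ℂ) / ℓ) ^ 2 / τ by push_cast; field_simp; ring,
    expTwoPi_add]
  ring

lemma torsionValue_pow_shift (h : IsJacobiForm k M c φ) {ℓ : ℕ} (hℓ : ℓ ≠ 0) (a b s t : ℤ)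
    (τ : ℍ) : torsionValue M φ ℓ (a + ℓ * s) (b + ℓ * t) τ ^ ℓ = torsionValue M φ ℓ a b τ ^ ℓ := by
  have hℓ' : (ℓ : ℂ) ≠ 0 := by exact_mod_cast hℓ
  have key : torsionValue M φ ℓ (a + ℓ * s) (b + ℓ * t) τ =
      expTwoPi ((M * (a * t - s * b + ℓ * s * t) : ℤ) / ℓ) * torsionValue M φ ℓ a b τ := by
    rw [torsionValue, torsionValue,
      show (((a + ℓ * s : ℤ) : ℂ) / ℓ) * τ + ((b + ℓ * t : ℤ) : ℂ) / ℓ =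
        ((a / ℓ : ℂ) * τ + b / ℓ) + s * τ + t by push_cast; field_simp; ring, h.elliptic,
      ← mul_assoc, ← mul_assoc, ← expTwoPi_add, ← expTwoPi_add]
    congr 2
    push_cast
    field_simp
    ring
  rw [key, mul_pow, ← expTwoPi_nat_mul, mul_div_cancel₀ _ hℓ', expTwoPi_int, one_mul]

lemma torsionExponent_nonneg (h : IsJacobiForm k M c φ) (ℓ : ℕ) (a : ℤ) {p : ℤ × ℤ}
    (hp : c p ≠ 0) : 0 ≤ torsionExponent M ℓ a p := by
  obtain ⟨h1, h2⟩ := h.support p hp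
  rw [torsionExponent]
  rcases h.index_nonneg.eq_or_lt with hM | hM
  · have : p.2 = 0 := by
      rw [← hM] at h2
      nlinarith
    rw [this, ← hM]
    nlinarith [mul_nonneg (sq_nonneg (ℓ : ℤ)) h1]
  · have : 0 ≤ 4 * M * (ℓ ^ 2 * p.1 + ℓ * p.2 * a + M * a ^ 2) := by
      nlinarith [sq_nonneg (ℓ * p.2 + 2 * M * a), mul_le_mul_of_nonneg_left h2 (sq_nonneg (ℓ : ℤ))]
    exact nonneg_of_mul_nonneg_right this (by linarith)

lemma finite_torsionExponent_le (h : IsJacobiForm k M c φ) {ℓ : ℕ} (hℓ : ℓ ≠ 0) (a j : ℤ) :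
    {p | torsionExponent M ℓ a p ≤ j ∧ c p ≠ 0}.Finite := by
  let R : ℤ := 4 * M * j + 2 * M * |a|
  refine ((Set.finite_Icc (0 : ℤ) (j + R * |a|)).prod (Set.finite_Icc (-R) R)).subset ?_
  rintro ⟨n, r⟩ ⟨hj, hc⟩
  have hJ := h.torsionExponent_nonneg ℓ a hc
  obtain ⟨h1, h2⟩ := h.support _ hc
  rw [torsionExponent] at hj hJ
  have hM := h.index_nonneg
  simp only at h1 h2 hj hJ
  have hℓ1 : (1 : ℤ) ≤ ℓ := by exact_mod_cast Nat.one_le_iff_ne_zero.mpr hℓ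
  have hsq : (ℓ * r + 2 * M * a) ^ 2 ≤ 4 * M * j := by
    nlinarith [mul_le_mul_of_nonneg_left h2 (sq_nonneg (ℓ : ℤ)), mul_le_mul_of_nonneg_left hj hM]
  have hx : |ℓ * r + 2 * M * a| ≤ 4 * M * j := by
    rw [← sq_abs] at hsq
    rcases (abs_nonneg (ℓ * r + 2 * M * a)).eq_or_lt with h0 | h0
    · rw [← h0] at hsq ⊢
      linarith
    · nlinarith
  have hℓr : |ℓ * r| ≤ R := by
    have := abs_sub (ℓ * r + 2 * M * a) (2 * M * a)
    rw [add_sub_cancel_right, abs_mul (2 * M) a, abs_of_nonneg (by linarith : 0 ≤ 2 * M)] at this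
    linarith
  have hr : |r| ≤ R := by
    refine le_trans ?_ hℓr
    rw [abs_mul, Nat.abs_cast]
    nlinarith [abs_nonneg r]
  refine ⟨⟨h1, ?_⟩, abs_le.mp hr⟩
  have h3 : -(ℓ * r * a) ≤ R * |a| := by
    refine (neg_le_abs _).trans ?_
    rw [abs_mul]
    exact mul_le_mul_of_nonneg_right hℓr (abs_nonneg a)
  have h4 : n ≤ ℓ ^ 2 * n := le_mul_of_one_le_left h1 (one_le_pow₀ hℓ1)
  have h5 : 0 ≤ M * a ^ 2 := by positivity
  simp only
  linarith

lemma finite_fiber (h : IsJacobiForm k M c φ) {ℓ : ℕ} (hℓ : ℓ ≠ 0) (a b : ℤ) (j : ℕ) :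
    {p | (torsionExponent M ℓ a p).toNat = j ∧ torsionCoeff M c ℓ a b p ≠ 0}.Finite := by
  refine (h.finite_torsionExponent_le hℓ a j).subset fun p hp => ⟨?_, left_ne_zero_of_mul hp.2⟩
  have := hp.1
  omega

/-- The `q`-expansion of width `ℓ²` of a torsion value. -/
def torsionSeries (h : IsJacobiForm k M c φ) {ℓ : ℕ} (hℓ : ℓ ≠ 0) (a b : ℤ) : PowerSeries ℂ :=
  PowerSeries.mk fun j => ∑ p ∈ (h.finite_fiber hℓ a b j).toFinset, torsionCoeff M c ℓ a b p

lemma hasQSeries_torsionValue (h : IsJacobiForm k M c φ) {ℓ : ℕ} (hℓ : ℓ ≠ 0) (a b : ℤ) :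
    HasQSeries (ℓ ^ 2) (torsionValue M φ ℓ a b) (h.torsionSeries hℓ a b) := fun τ => by
  have hℓ' : (ℓ : ℂ) ≠ 0 := by exact_mod_cast hℓ
  simp only [torsionSeries, PowerSeries.coeff_mk]
  refine HasSum.group_exponents (J := fun p => (torsionExponent M ℓ a p).toNat)
    (h.finite_fiber hℓ a b) ?_
  refine HasSum.of_term_eq ((h.expansion τ ((a / ℓ : ℂ) * τ + (b / ℓ : ℂ))).mul_left
    (expTwoPi (M * ((a / ℓ : ℂ) ^ 2 * τ + (a / ℓ : ℂ) * (b / ℓ : ℂ))))) fun p => ?_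
  by_cases hp : c p = 0
  · simp [torsionCoeff, hp]
  have hq : qParam ((ℓ ^ 2 : ℕ) : ℝ) τ ^ (torsionExponent M ℓ a p).toNat =
      expTwoPi ((torsionExponent M ℓ a p : ℤ) * (τ / ℓ ^ 2)) := by
    conv_rhs => rw [← Int.toNat_of_nonneg (h.torsionExponent_nonneg ℓ a hp)]
    rw [Int.cast_natCast, expTwoPi_nat_mul]
    congr 1
    rw [qParam, expTwoPi]
    congr 1
    push_cast
    ring
  rw [hq, torsionCoeff, mul_assoc, ← expTwoPi_add, mul_left_comm (expTwoPi _), ← expTwoPi_add]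
  congr 2
  rw [torsionExponent]
  push_cast
  field_simp
  ring

end IsJacobiForm

end JacobiForms

section JacobiOrders

open UpperHalfPlane ModularForm MatrixGroups

variable {k M : ℤ} {c : ℤ × ℤ → ℂ} {φ : ℍ → ℂ → ℂ}

namespace IsJacobiForm

lemma valuation_torsionCoeff {Γ₀ : Type*} [LinearOrderedCommGroupWithZero Γ₀] (v : Valuation ℂ Γ₀)
    {ℓ : ℕ} (hℓ : ℓ ≠ 0) (a b : ℤ) (p : ℤ × ℤ) :
    v (torsionCoeff M c ℓ a b p) = v (c p) := by
  have hℓ' : (ℓ : ℂ) ≠ 0 := by exact_mod_cast hℓ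
  suffices hpow : expTwoPi (p.2 * (b / ℓ : ℂ) + M * ((a / ℓ : ℂ) * (b / ℓ : ℂ))) ^ ℓ ^ 2 = 1 by
    rw [torsionCoeff, map_mul, valuation_eq_one_of_pow_eq_one v (by positivity) hpow, mul_one]
  rw [← expTwoPi_nat_mul, ← expTwoPi_int (p.2 * b * ℓ + M * a * b)]
  congr 1
  push_cast
  field_simp

lemma hasValOrder_torsionSeries {Γ₀ : Type*} [LinearOrderedCommGroupWithZero Γ₀]
    {v : Valuation ℂ Γ₀} (h : IsJacobiForm k M c φ) (hc : ∀ p, v (c p) ≤ 1) {ℓ : ℕ} (hℓ : ℓ ≠ 0)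
    (a b : ℤ) {j : ℕ} (hj : v ((h.torsionSeries hℓ a b).coeff j) = 1) :
    ∃ o : ℕ, HasValOrder v (h.torsionSeries hℓ a b) o ∧
      ∃ p, v (c p) = 1 ∧ (o : ℤ) = torsionExponent M ℓ a p := by
  classical
  have hle : ∀ n, v ((h.torsionSeries hℓ a b).coeff n) ≤ 1 := fun n => by
    rw [torsionSeries, PowerSeries.coeff_mk]
    exact v.map_sum_le fun p _ => by rw [valuation_torsionCoeff v hℓ]; exact hc p
  obtain ⟨o, hspec, hmin⟩ : ∃ o, v ((h.torsionSeries hℓ a b).coeff o) = 1 ∧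
      ∀ n < o, v ((h.torsionSeries hℓ a b).coeff n) ≠ 1 := by
    have hex : ∃ j, v ((h.torsionSeries hℓ a b).coeff j) = 1 := ⟨j, hj⟩
    exact ⟨Nat.find hex, Nat.find_spec hex, fun n hn => Nat.find_min hex hn⟩
  refine ⟨o, ⟨hle, fun n hn => (hle n).lt_of_ne (hmin n hn), hspec⟩, ?_⟩
  by_contra! hno
  refine hspec.not_lt ?_
  rw [torsionSeries, PowerSeries.coeff_mk]
  refine v.map_sum_lt one_ne_zero fun p hp => ?_
  rw [Set.Finite.mem_toFinset] at hp
  rw [valuation_torsionCoeff v hℓ]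
  refine (hc p).lt_of_ne fun h1 => hno p h1 ?_
  rw [← hp.1, Int.toNat_of_nonneg (h.torsionExponent_nonneg ℓ a (left_ne_zero_of_mul hp.2))]

/-- At torsion points off the real axis a large prime level separates the minimal exponents. -/
lemma exists_coeff_eq_one_of_ne_zero {Γ₀ : Type*} [LinearOrderedCommGroupWithZero Γ₀]
    {v : Valuation ℂ Γ₀} (h : IsJacobiForm k M c φ) (hc : ∀ p, v (c p) ≤ 1) {p₀ : ℤ × ℤ}
    (hp₀ : v (c p₀) = 1) {ℓ : ℕ} (hℓ : ℓ.Prime)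
    (hbig : 2 * (4 * M * (p₀.1 + |p₀.2| + 1)) < ℓ) {a : ℤ} (ha : 0 < a) (haℓ : a < ℓ) (b : ℤ) :
    ∃ j, v ((h.torsionSeries hℓ.ne_zero a b).coeff j) = 1 := by
  have hne : ∀ {p}, v (c p) = 1 → c p ≠ 0 := fun {p} hp h0 => by
    rw [h0, map_zero] at hp; exact zero_ne_one hp
  obtain ⟨p, hp, hmin⟩ := (measure fun p => (torsionExponent M ℓ a p).toNat).wf.has_min
    {p | v (c p) = 1} ⟨p₀, hp₀⟩
  have hle : ∀ {p'}, v (c p') = 1 → torsionExponent M ℓ a p ≤ torsionExponent M ℓ a p' :=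
    fun {p'} hp' => by
      have h1 : ¬ (torsionExponent M ℓ a p').toNat < (torsionExponent M ℓ a p).toNat := hmin p' hp'
      have := h.torsionExponent_nonneg ℓ a (hne hp')
      omega
  have hM := h.index_nonneg
  have hℓ0 : (0 : ℤ) < ℓ := by exact_mod_cast hℓ.pos
  have hbound : ∀ {p'}, v (c p') = 1 → torsionExponent M ℓ a p' = torsionExponent M ℓ a p →
      |p'.2| ≤ 4 * M * (p₀.1 + |p₀.2| + 1) := fun {p'} hp' heq => by
    have h1 := (heq.le).trans (hle hp₀)
    obtain ⟨h2, h3⟩ := h.support _ (hne hp')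
    obtain ⟨h4, -⟩ := h.support _ (hne hp₀)
    rw [torsionExponent, torsionExponent] at h1
    have h5 : ℓ * p'.1 ≤ ℓ * (p₀.1 + |p₀.2| + |p'.2|) := by
      have h6 : ℓ * (ℓ * p'.1) ≤ ℓ * (ℓ * p₀.1 + (|p₀.2| + |p'.2|) * a) := by
        have := mul_le_mul_of_nonneg_right
          (show p₀.2 - p'.2 ≤ |p₀.2| + |p'.2| by
            linarith [le_abs_self p₀.2, neg_abs_le p'.2]) ha.le
        nlinarith
      have h7 := le_of_mul_le_mul_left h6 hℓ0
      have h8 := mul_le_mul_of_nonneg_left haℓ.le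
        (show 0 ≤ |p₀.2| + |p'.2| by positivity)
      linarith
    have h6 := le_of_mul_le_mul_left h5 hℓ0
    have h7 : |p'.2| ^ 2 ≤ 4 * M * (p₀.1 + |p₀.2| + |p'.2|) := by
      rw [sq_abs]
      exact h3.trans (mul_le_mul_of_nonneg_left h6 (by linarith))
    rcases (abs_nonneg p'.2).eq_or_lt with h0 | h0
    · rw [← h0]; positivity
    · have h9 : p₀.1 + |p₀.2| + |p'.2| ≤ (p₀.1 + |p₀.2| + 1) * |p'.2| := by
        have : 0 ≤ (p₀.1 + |p₀.2|) * (|p'.2| - 1) :=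
          mul_nonneg (by positivity) (by linarith [Int.add_one_le_iff.mpr h0])
        linarith
      have h10 := h7.trans (mul_le_mul_of_nonneg_left h9 (show 0 ≤ 4 * M by linarith))
      rw [pow_two, ← mul_assoc] at h10
      exact le_of_mul_le_mul_right h10 h0
  have huniq : ∀ {p'}, v (c p') = 1 → torsionExponent M ℓ a p' = torsionExponent M ℓ a p →
      p' = p := fun {p'} hp' heq => by
    have h1 := hbound hp' heq
    have h2 := hbound hp rfl
    rw [torsionExponent, torsionExponent] at heq
    have h3 : ℓ * p'.1 + p'.2 * a = ℓ * p.1 + p.2 * a := by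
      refine mul_left_cancel₀ hℓ0.ne' ?_
      linarith
    have hdvd : (ℓ : ℤ) ∣ (p'.2 - p.2) * a := ⟨p.1 - p'.1, by linarith⟩
    have hr : p'.2 - p.2 = 0 := by
      rcases (Nat.prime_iff_prime_int.mp hℓ).dvd_or_dvd hdvd with h4 | h4
      · refine Int.eq_zero_of_abs_lt_dvd h4 ?_
        have := abs_sub p'.2 p.2
        linarith
      · exact absurd (Int.le_of_dvd ha h4) (by linarith)
    have hr' : p'.2 = p.2 := by linarith
    rw [hr'] at h3
    have hn : p'.1 = p.1 := mul_left_cancel₀ hℓ0.ne' (by linarith)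
    exact Prod.ext hn hr'
  refine ⟨(torsionExponent M ℓ a p).toNat, ?_⟩
  have hmem : p ∈ (h.finite_fiber hℓ.ne_zero a b (torsionExponent M ℓ a p).toNat).toFinset := by
    rw [Set.Finite.mem_toFinset]
    exact ⟨rfl, mul_ne_zero (hne hp) (expTwoPi_ne_zero _)⟩
  rw [torsionSeries, PowerSeries.coeff_mk, ← Finset.add_sum_erase _ _ hmem]
  have h1 : v (torsionCoeff M c ℓ a b p) = 1 := by rw [valuation_torsionCoeff v hℓ.ne_zero]; exact hp
  rw [v.map_add_eq_of_lt_left, h1]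
  rw [h1]
  refine v.map_sum_lt one_ne_zero fun p' hp' => ?_
  rw [Finset.mem_erase, Set.Finite.mem_toFinset] at hp'
  rw [valuation_torsionCoeff v hℓ.ne_zero]
  refine (hc p').lt_of_ne fun h2 => hp'.1 (huniq h2 ?_)
  have h3 := h.torsionExponent_nonneg ℓ a (hne h2)
  have h4 := h.torsionExponent_nonneg ℓ a (hne hp)
  have h5 := hp'.2.1
  omega

/-- At torsion points on the real axis the coefficient of a fixed power of `q` is a Laurent
polynomial evaluated at a root of unity. -/
lemma coeff_torsionSeries_zero (h : IsJacobiForm k M c φ) {ℓ : ℕ} (hℓ : ℓ ≠ 0) (b : ℤ) {n : ℤ}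
    (hn : 0 ≤ n) :
    (h.torsionSeries hℓ 0 b).coeff (ℓ ^ 2 * n.toNat) =
      ∑ r ∈ Finset.Icc (-(4 * M * n)) (4 * M * n), c (n, r) * expTwoPi (b / ℓ : ℂ) ^ r := by
  have hℓ0 : (0 : ℤ) < (ℓ : ℤ) ^ 2 := by positivity
  have hexp : ∀ {p : ℤ × ℤ}, c p ≠ 0 →
      ((torsionExponent M ℓ 0 p).toNat = ℓ ^ 2 * n.toNat ↔ p.1 = n) := fun {p} hp => by
    have hnn := h.torsionExponent_nonneg ℓ 0 hp
    have h1 : torsionExponent M ℓ 0 p = ℓ ^ 2 * p.1 := by simp [torsionExponent]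
    rw [h1] at hnn
    rw [← Int.natCast_inj, h1, Int.toNat_of_nonneg hnn]
    push_cast
    rw [Int.toNat_of_nonneg hn]
    exact ⟨fun h2 => mul_left_cancel₀ hℓ0.ne' h2, fun h2 => by rw [h2]⟩
  rw [torsionSeries, PowerSeries.coeff_mk]
  refine Finset.sum_bij_ne_zero (fun p _ _ => p.2) ?_ ?_ ?_ ?_
  · intro p hp _
    rw [Set.Finite.mem_toFinset] at hp
    have hcp := left_ne_zero_of_mul hp.2
    obtain ⟨-, h2⟩ := h.support p hcp
    rw [(hexp hcp).mp hp.1] at h2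
    rw [Finset.mem_Icc, ← abs_le]
    rcases (abs_nonneg p.2).eq_or_lt with h0 | h0
    · rw [← h0]; have := h.index_nonneg; positivity
    · rw [← sq_abs] at h2
      nlinarith
  · intro p hp _ p' hp' _ heq
    rw [Set.Finite.mem_toFinset] at hp hp'
    exact Prod.ext (((hexp (left_ne_zero_of_mul hp.2)).mp hp.1).trans
      ((hexp (left_ne_zero_of_mul hp'.2)).mp hp'.1).symm) heq
  · intro r _ hr
    have hcr := left_ne_zero_of_mul hr
    have h2 : torsionCoeff M c ℓ 0 b (n, r) ≠ 0 := mul_ne_zero hcr (expTwoPi_ne_zero _)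
    exact ⟨(n, r), by
      rw [Set.Finite.mem_toFinset]; exact ⟨(hexp hcr).mpr rfl, h2⟩, h2, rfl⟩
  · intro p hp _
    rw [Set.Finite.mem_toFinset] at hp
    have h1 := (hexp (left_ne_zero_of_mul hp.2)).mp hp.1
    rw [torsionCoeff, ← expTwoPi_int_mul, ← h1]
    simp

lemma isPrimitiveRoot_expTwoPi {ℓ : ℕ} (hℓ : ℓ.Prime) {b : ℤ} (hb : 0 < b) (hbℓ : b < ℓ) :
    IsPrimitiveRoot (expTwoPi (b / ℓ : ℂ)) ℓ := by
  lift b to ℕ using hb.le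
  have hcop : b.Coprime ℓ :=
    (Nat.coprime_of_lt_prime (by omega) (by omega) hℓ).symm
  have := Complex.isPrimitiveRoot_exp_of_coprime b ℓ hℓ.ne_zero hcop
  simpa [expTwoPi] using this

end IsJacobiForm

end JacobiOrders

section TorsionProduct

open UpperHalfPlane ModularForm MatrixGroups

variable {k M : ℤ} {c : ℤ × ℤ → ℂ} {φ : ℍ → ℂ → ℂ}

namespace IsJacobiForm

lemma torsionValue_pow_eq_val (h : IsJacobiForm k M c φ) {ℓ : ℕ} [NeZero ℓ] (a b : ℤ) (τ : ℍ) :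
    torsionValue M φ ℓ a b τ ^ ℓ =
      torsionValue M φ ℓ ((a : ZMod ℓ).val : ℤ) ((b : ZMod ℓ).val : ℤ) τ ^ ℓ := by
  have key := h.torsionValue_pow_shift (NeZero.ne ℓ) (a % ℓ) (b % ℓ) (a / ℓ) (b / ℓ) τ
  rw [Int.emod_add_mul_ediv, Int.emod_add_mul_ediv] at key
  rw [key, ZMod.val_intCast, ZMod.val_intCast]

/-- The action of `T` on torsion classes. -/
def torsionShift (ℓ : ℕ) : ZMod ℓ × ZMod ℓ ≃ ZMod ℓ × ZMod ℓ where
  toFun w := (w.1, w.1 + w.2)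
  invFun w := (w.1, w.2 - w.1)
  left_inv w := by simp
  right_inv w := by simp

/-- The action of `S` on torsion classes. -/
def torsionRotate (ℓ : ℕ) : ZMod ℓ × ZMod ℓ ≃ ZMod ℓ × ZMod ℓ where
  toFun w := (w.2, -w.1)
  invFun w := (-w.2, w.1)
  left_inv w := by simp
  right_inv w := by simp

/-- The product of the `12ℓ`-th powers of all values at primitive torsion points is a modular form
of level one. -/
lemma exists_modularForm_prod_torsionValue (h : IsJacobiForm k M c φ) {ℓ : ℕ} [Fact ℓ.Prime] :
    ∃ f : ModularForm 𝒮ℒ (12 * (k * ℓ * (ℓ ^ 2 - 1))),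
      (f : ℍ → ℂ) = ∏ w ∈ (Finset.univ.erase 0 : Finset (ZMod ℓ × ZMod ℓ)),
        torsionValue M φ ℓ w.1.val w.2.val ^ (ℓ * 12) := by
  classical
  have hℓ0 : ℓ ≠ 0 := NeZero.ne ℓ
  let s : Finset (ZMod ℓ × ZMod ℓ) := Finset.univ.erase 0
  have hcard : (s.card : ℤ) = ℓ ^ 2 - 1 := by
    rw [Finset.card_erase_of_mem (Finset.mem_univ _), Finset.card_univ, Fintype.card_prod,
      ZMod.card, Nat.cast_sub (Nat.one_le_iff_ne_zero.mpr (by positivity))]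
    push_cast
    ring
  refine HasQSeries.exists_modularForm (N := ℓ ^ 2) (by positivity)
    (HasQSeries.prod s fun w _ => (h.hasQSeries_torsionValue hℓ0 w.1.val w.2.val).pow (ℓ * 12))
    (fun τ => ?_) (fun τ => ?_)
  · simp only [Finset.prod_apply, Pi.pow_apply, pow_mul]
    refine Finset.prod_equiv (torsionShift ℓ) (fun w => ?_) (fun w _ => ?_)
    · simp only [s, torsionShift, Finset.mem_erase, Finset.mem_univ, and_true, Equiv.coe_fn_mk, ne_eq,
        Prod.ext_iff, Prod.fst_zero, Prod.snd_zero]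
      refine not_congr (and_congr_right fun h0 => ?_)
      rw [h0, zero_add]
    · rw [h.torsionValue_vadd_one, h.torsionValue_pow_eq_val]
      simp [torsionShift]
  · simp only [Finset.prod_apply, Pi.pow_apply, pow_mul]
    have hpow : (τ : ℂ) ^ (12 * (k * ℓ * (ℓ ^ 2 - 1)) : ℤ) = ∏ _w ∈ s, (((τ : ℂ) ^ k) ^ ℓ) ^ 12 := by
      rw [Finset.prod_const, ← zpow_natCast, ← zpow_natCast, ← zpow_natCast, ← _root_.zpow_mul,
        ← _root_.zpow_mul, ← _root_.zpow_mul, hcard]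
      congr 1
      push_cast
      ring
    rw [hpow]
    change ∏ w ∈ s, _ = _ * ∏ w ∈ s, _
    have : ∏ w ∈ s, (torsionValue M φ ℓ w.1.val w.2.val τ ^ ℓ) ^ 12 =
        ∏ w ∈ s, (torsionValue M φ ℓ w.2.val (-w.1.val) τ ^ ℓ) ^ 12 := by
      refine (Finset.prod_equiv (torsionRotate ℓ) (fun w => ?_) (fun w _ => ?_)).symm
      · simp [s, torsionRotate, Prod.ext_iff, and_comm]
      · rw [h.torsionValue_pow_eq_val]
        simp [torsionRotate]
    rw [this, ← Finset.prod_mul_distrib]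
    refine Finset.prod_congr rfl fun w _ => ?_
    rw [h.torsionValue_S_smul, mul_pow, mul_pow]

/-- The vanishing orders of a Jacobi form modulo a valuation at the primitive torsion points of a
large prime order are bounded on average by its weight. -/
theorem exists_torsion_orders (h : IsJacobiForm k M c φ) (A : ValuationSubring ℂ)
    (h6 : A.valuation 1728 = 1) (hc : ∀ p, A.valuation (c p) ≤ 1) {p₀ : ℤ × ℤ}
    (hp₀ : A.valuation (c p₀) = 1) :
    ∃ L : ℕ, ∀ ℓ : ℕ, ℓ.Prime → L ≤ ℓ → A.valuation (ℓ : ℂ) = 1 →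
      ∃ o : ZMod ℓ × ZMod ℓ → ℕ,
        (∀ w, w ≠ 0 → ∃ p, A.valuation (c p) = 1 ∧ (o w : ℤ) = torsionExponent M ℓ w.1.val p) ∧
        ∀ s : Finset (ZMod ℓ × ZMod ℓ), (∀ w, w ∈ s ↔ w ≠ 0) →
          12 * ∑ w ∈ s, (o w : ℤ) ≤ k * ℓ ^ 2 * (ℓ ^ 2 - 1) := by
  classical
  obtain ⟨n₀, r₀⟩ := p₀
  have hne : c (n₀, r₀) ≠ 0 := fun h0 => by
    rw [h0, map_zero] at hp₀; exact zero_ne_one hp₀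
  obtain ⟨hn₀, hr₀⟩ := h.support _ hne
  simp only at hn₀ hr₀
  have hM := h.index_nonneg
  have hmem : r₀ ∈ Finset.Icc (-(4 * M * n₀)) (4 * M * n₀) := by
    rw [Finset.mem_Icc, ← abs_le]
    rw [← sq_abs] at hr₀
    rcases (abs_nonneg r₀).eq_or_lt with h0 | h0
    · rw [← h0]; positivity
    · nlinarith
  obtain ⟨L₁, hL₁⟩ := exists_valuation_laurent_eq_one A _ (fun r => c (n₀, r)) (fun r => hc _)
    hmem hp₀
  refine ⟨max L₁ ((2 * (4 * M * (n₀ + |r₀| + 1))).toNat + 1), fun ℓ hℓ hL hv => ?_⟩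
  have : Fact ℓ.Prime := ⟨hℓ⟩
  have hval : ∀ t : ZMod ℓ, t ≠ 0 → (0 : ℤ) < t.val ∧ (t.val : ℤ) < ℓ := fun t ht =>
    ⟨by exact_mod_cast Nat.pos_of_ne_zero ((ZMod.val_ne_zero t).mpr ht),
      by exact_mod_cast ZMod.val_lt t⟩
  have hex : ∀ w : ZMod ℓ × ZMod ℓ, w ≠ 0 → ∃ o : ℕ,
      HasValOrder A.valuation (h.torsionSeries hℓ.ne_zero w.1.val w.2.val) o ∧
      ∃ p, A.valuation (c p) = 1 ∧ (o : ℤ) = torsionExponent M ℓ w.1.val p := by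
    rintro ⟨x, y⟩ hw
    suffices ∃ j, A.valuation ((h.torsionSeries hℓ.ne_zero x.val y.val).coeff j) = 1 by
      obtain ⟨j, hj⟩ := this
      exact h.hasValOrder_torsionSeries hc hℓ.ne_zero _ _ hj
    by_cases hx : x = 0
    · have hy : y ≠ 0 := fun hy => hw (by simp [hx, hy])
      subst hx
      refine ⟨ℓ ^ 2 * n₀.toNat, ?_⟩
      rw [ZMod.val_zero, Nat.cast_zero, h.coeff_torsionSeries_zero hℓ.ne_zero _ hn₀]
      exact hL₁ ℓ hℓ ((le_max_left _ _).trans hL) hv _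
        (isPrimitiveRoot_expTwoPi hℓ (hval y hy).1 (hval y hy).2)
    · refine h.exists_coeff_eq_one_of_ne_zero hc hp₀ hℓ ?_ (hval x hx).1 (hval x hx).2 _
      have := (le_max_right _ _).trans hL
      simp only
      omega
  choose! o ho using hex
  refine ⟨o, fun w hw => (ho w hw).2, fun s hs => ?_⟩
  obtain ⟨f, hf⟩ := h.exists_modularForm_prod_torsionValue (ℓ := ℓ)
  have hs' : (Finset.univ.erase 0 : Finset (ZMod ℓ × ZMod ℓ)) = s := by
    ext w; simp [hs]
  rw [hs'] at hf
  have hB : HasQSeries (ℓ ^ 2) f (∏ w ∈ s,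
      h.torsionSeries hℓ.ne_zero w.1.val w.2.val ^ (ℓ * 12)) := by
    rw [hf]
    exact HasQSeries.prod s fun w _ =>
      (h.hasQSeries_torsionValue hℓ.ne_zero w.1.val w.2.val).pow (ℓ * 12)
  have hO := HasValOrder.prod (v := A.valuation) s
    (fun w hw => ((ho w ((hs w).mp hw)).1).pow (ℓ * 12))
  have hle := hO.le_of_modularForm h6 (pow_pos hℓ.pos 2) rfl f hB
  rw [← Finset.mul_sum] at hle
  push_cast at hle
  have hℓ1 : (0 : ℤ) < ℓ := by exact_mod_cast hℓ.pos
  refine le_of_mul_le_mul_left ?_ hℓ1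
  linarith

end IsJacobiForm

end TorsionProduct

section HexagonalLattice

/-- A quadratic polynomial with leading form `m (a² + ab + b²)` that is bounded below by `N` on the
integers is bounded below at rational points by interpolation on the Delaunay triangles of the
hexagonal lattice. -/
lemma hexagonal_interpolation_bound {n A B m N : ℤ}
    (hmin : ∀ a b : ℤ, N ≤ n + A * a + B * b + m * (a ^ 2 + a * b + b ^ 2)) {ℓ t : ℤ}
    (ht : 0 ≤ t) (htℓ : t < ℓ) (u : ℤ) :
    2 * N * ℓ ^ 2 - m * (t * (ℓ - t) + (u % ℓ) * (ℓ - u % ℓ) +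
      ((u + t) % ℓ) * (ℓ - (u + t) % ℓ)) ≤
      2 * (ℓ ^ 2 * n + ℓ * (A * t + B * u) + m * (t ^ 2 + t * u + u ^ 2)) := by
  have hℓ : 0 < ℓ := ht.trans_lt htℓ
  obtain ⟨y, q, hu, hy0, hyℓ, hy⟩ : ∃ y q : ℤ, u = y + ℓ * q ∧ 0 ≤ y ∧ y < ℓ ∧ u % ℓ = y :=
    ⟨u % ℓ, u / ℓ, (Int.emod_add_mul_ediv u ℓ).symm, Int.emod_nonneg _ hℓ.ne',
      Int.emod_lt_of_pos _ hℓ, rfl⟩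
  rw [hy]
  have h10 := hmin 1 q
  have h01 := hmin 0 (q + 1)
  rcases lt_or_ge (y + t) ℓ with hlt | hge
  · have hz : (u + t) % ℓ = y + t := by
      rw [hu, show y + ℓ * q + t = (y + t) + ℓ * q by ring, Int.add_mul_emod_self_left,
        Int.emod_eq_of_lt (by linarith) hlt]
    have h00 := hmin 0 q
    have e0 := mul_le_mul_of_nonneg_left h00 (by nlinarith : 0 ≤ 2 * ℓ * (ℓ - t - y))
    have e1 := mul_le_mul_of_nonneg_left h10 (by positivity : 0 ≤ 2 * ℓ * t)
    have e2 := mul_le_mul_of_nonneg_left h01 (by positivity : 0 ≤ 2 * ℓ * y)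
    rw [hz, hu]
    linarith
  · have hz : (u + t) % ℓ = y + t - ℓ := by
      rw [hu, show y + ℓ * q + t = (y + t - ℓ) + ℓ * (q + 1) by ring, Int.add_mul_emod_self_left,
        Int.emod_eq_of_lt (by linarith) (by linarith)]
    have h11 := hmin 1 (q + 1)
    have e0 := mul_le_mul_of_nonneg_left h11 (by nlinarith : 0 ≤ 2 * ℓ * (t + y - ℓ))
    have e1 := mul_le_mul_of_nonneg_left h10 (by nlinarith : 0 ≤ 2 * ℓ * (ℓ - y))
    have e2 := mul_le_mul_of_nonneg_left h01 (by nlinarith : 0 ≤ 2 * ℓ * (ℓ - t))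
    rw [hz, hu]
    linarith

lemma six_mul_sum_range_mul_sub (L : ℤ) (n : ℕ) :
    6 * ∑ i ∈ Finset.range n, (i : ℤ) * (L - i) = 3 * L * n * (n - 1) - n * (n - 1) * (2 * n - 1) := by
  induction n with
  | zero => simp
  | succ n ih => rw [Finset.sum_range_succ, mul_add, ih]; push_cast; ring

lemma ZMod.six_mul_sum_val_mul_sub {ℓ : ℕ} [NeZero ℓ] :
    6 * ∑ t : ZMod ℓ, (t.val : ℤ) * (ℓ - t.val) = (ℓ : ℤ) ^ 3 - ℓ := by
  obtain ⟨n, rfl⟩ := Nat.exists_eq_succ_of_ne_zero (NeZero.ne ℓ)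
  have : ∑ t : ZMod (n + 1), (t.val : ℤ) * (((n + 1 : ℕ) : ℤ) - t.val) =
      ∑ i ∈ Finset.range (n + 1), (i : ℤ) * (((n + 1 : ℕ) : ℤ) - i) :=
    Fin.sum_univ_eq_sum_range (fun i => (i : ℤ) * (((n + 1 : ℕ) : ℤ) - i)) (n + 1)
  refine (congrArg (6 * ·) this).trans ?_
  simp only [six_mul_sum_range_mul_sub]
  push_cast
  ring

lemma ZMod.six_mul_sum_val_mul_sub_mul {ℓ : ℕ} [Fact ℓ.Prime] {c : ZMod ℓ} (hc : c ≠ 0) :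
    6 * ∑ t : ZMod ℓ, ((c * t).val : ℤ) * (ℓ - (c * t).val) = (ℓ : ℤ) ^ 3 - ℓ := by
  rw [← ZMod.six_mul_sum_val_mul_sub]
  congr 1
  exact Equiv.sum_comp (Equiv.mulLeft₀ c hc) fun t : ZMod ℓ => (t.val : ℤ) * (ℓ - t.val)

end HexagonalLattice

section FourierJacobi

open UpperHalfPlane

/-- The Fourier coefficients, in the coordinates `(n, A, B, m)`, of a symmetric-type expansion
of degree two over the hexagonal lattice: they are supported on positive semidefinite indices and
invariant under the action of the special linear group. -/
structure IsHexagonalExpansion (a : ℤ → ℤ → ℤ → ℤ → ℂ) : Prop where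
  support : ∀ n A B m, a n A B m ≠ 0 → 0 ≤ n ∧ 0 ≤ m ∧ A ^ 2 - A * B + B ^ 2 ≤ 3 * (n * m)
  translate : ∀ n A B m x y, a n A B m =
    a (n + A * x + B * y + m * (x ^ 2 + x * y + y ^ 2)) (A + m * (2 * x + y)) (B + m * (x + 2 * y)) m
  swap : ∀ n A B m, a n A B m = a m (-A) (B - A) n

/-- The Fourier coefficients of the restriction of the `m`-th Fourier-Jacobi coefficient to the line
spanned by `(1, s)`. -/
def lineCoeff (a : ℤ → ℤ → ℤ → ℤ → ℂ) (m s : ℤ) (p : ℤ × ℤ) : ℂ :=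
  ∑ B ∈ Finset.Icc (-(4 * (p.1 * m))) (4 * (p.1 * m)), a p.1 (p.2 - s * B) B m

variable {a : ℤ → ℤ → ℤ → ℤ → ℂ}

lemma abs_le_of_sq_le {x R : ℤ} (hR : 0 ≤ R) (h : x ^ 2 ≤ R) : |x| ≤ R := by
  rw [← sq_abs] at h
  rcases (abs_nonneg x).eq_or_lt with h0 | h0
  · rwa [← h0]
  · nlinarith

lemma IsHexagonalExpansion.abs_le (h : IsHexagonalExpansion a) {n A B m : ℤ}
    (hne : a n A B m ≠ 0) : |A| ≤ 4 * (n * m) ∧ |B| ≤ 4 * (n * m) := by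
  obtain ⟨hn, hm, hQ⟩ := h.support _ _ _ _ hne
  have h0 : 0 ≤ 4 * (n * m) := by positivity
  exact ⟨abs_le_of_sq_le h0 (by nlinarith [sq_nonneg (A - 2 * B)]),
    abs_le_of_sq_le h0 (by nlinarith [sq_nonneg (B - 2 * A)])⟩

lemma IsHexagonalExpansion.lineCoeff_eq (h : IsHexagonalExpansion a) {n A B m s : ℤ}
    (hne : a n A B m ≠ 0) (hs : 8 * (n * m) < s) : lineCoeff a m s (n, A + s * B) = a n A B m := by
  obtain ⟨hA, hB⟩ := h.abs_le hne
  rw [lineCoeff, Finset.sum_eq_single B]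
  · simp
  · intro B' _ hB'
    by_contra hne'
    have h1 := (h.abs_le hne').1
    simp only at h1
    have h2 : |s * (B - B')| ≤ 8 * (n * m) := by
      calc |s * (B - B')| = |(A + s * B - s * B') - A| := by congr 1; ring
        _ ≤ |A + s * B - s * B'| + |A| := abs_sub _ _
        _ ≤ _ := by linarith
    have h3 : 1 ≤ |B - B'| := Int.one_le_abs (sub_ne_zero.mpr (Ne.symm hB'))
    have h4 := abs_nonneg A
    rw [abs_mul, abs_of_nonneg (by linarith : 0 ≤ s)] at h2
    nlinarith
  · intro hB'
    exact absurd (Finset.mem_Icc.mpr (_root_.abs_le.mp hB)) hB'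

/-- A Sturm-type bound for expansions of degree two over the hexagonal lattice all of whose
restricted Fourier-Jacobi coefficients are Jacobi forms of weight `k`. -/
theorem IsHexagonalExpansion.valuation_lt_one (h : IsHexagonalExpansion a) {k : ℤ}
    (hJ : ∀ m s : ℤ, 0 ≤ m → ∃ φ, IsJacobiForm k (m * (1 + s + s ^ 2)) (lineCoeff a m s) φ)
    (O : ValuationSubring ℂ) (h6 : O.valuation 1728 = 1)
    {q : ℕ} (hq : ∀ ℓ : ℕ, ℓ.Prime → ℓ ≠ q → O.valuation (ℓ : ℂ) = 1)
    (hint : ∀ n A B m, O.valuation (a n A B m) ≤ 1)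
    (hvan : ∀ n A B m, 0 ≤ n → 0 ≤ m → 9 * n ≤ k → 9 * m ≤ k → O.valuation (a n A B m) < 1)
    (n A B m : ℤ) : O.valuation (a n A B m) < 1 := by
  classical
  by_contra hcon
  have hne : ∀ {n A B m}, O.valuation (a n A B m) = 1 → a n A B m ≠ 0 := fun hp h0 => by
    rw [h0, map_zero] at hp; exact zero_ne_one hp
  have hex : ∃ m : ℕ, ∃ n A B : ℤ, O.valuation (a n A B m) = 1 := by
    have h1 := le_antisymm (hint n A B m) (not_lt.mp hcon)
    refine ⟨m.toNat, n, A, B, ?_⟩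
    rwa [Int.toNat_of_nonneg (h.support _ _ _ _ (hne h1)).2.1]
  obtain ⟨n₀, A₀, B₀, h₀⟩ := Nat.find_spec hex
  set m₀ := Nat.find hex with hm₀
  have hm₀0 : (0 : ℤ) ≤ m₀ := Int.natCast_nonneg _
  obtain ⟨N, hN⟩ : ∃ N : ℤ, N = max (k / 9 + 1) m₀ := ⟨_, rfl⟩
  have hN1 : k / 9 + 1 ≤ N := hN ▸ le_max_left _ _
  have hN2 : (m₀ : ℤ) ≤ N := hN ▸ le_max_right _ _
  have hlow : ∀ {n A B : ℤ}, O.valuation (a n A B m₀) = 1 → N ≤ n := fun {n A B} h1 => by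
    have hn := (h.support _ _ _ _ (hne h1)).1
    by_contra! hlt
    rcases lt_or_ge n m₀ with hnm | hnm
    · refine Nat.find_min hex (m := n.toNat) (by omega) ⟨m₀, -A, B - A, ?_⟩
      rw [Int.toNat_of_nonneg hn, ← h.swap]
      exact h1
    · refine (hvan n A B m₀ hn hm₀0 ?_ ?_).ne h1 <;> omega
  have hn₀ := (h.support _ _ _ _ (hne h₀)).1
  obtain ⟨s, hs⟩ : ∃ s : ℤ, s = 8 * (n₀ * m₀) + 1 := ⟨_, rfl⟩
  have hs0 : 0 < s := by rw [hs]; positivity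
  obtain ⟨φ, hφ⟩ := hJ m₀ s hm₀0
  have hc : ∀ p, O.valuation (lineCoeff a m₀ s p) ≤ 1 := fun p =>
    O.valuation.map_sum_le fun B _ => hint _ _ _ _
  obtain ⟨L, hL⟩ := hφ.exists_torsion_orders O h6 hc (p₀ := (n₀, A₀ + s * B₀))
    (by rw [h.lineCoeff_eq (hne h₀) (by linarith)]; exact h₀)
  obtain ⟨ℓ, hℓL, hℓ⟩ := Nat.exists_infinite_primes (max L (max (q + 1) (s.toNat + 2)))
  simp only [max_le_iff] at hℓL
  have : Fact ℓ.Prime := ⟨hℓ⟩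
  obtain ⟨o, ho, hsum⟩ := hL ℓ hℓ hℓL.1 (hq ℓ hℓ (by omega))
  have hsum := hsum (Finset.univ.erase 0) (by simp)
  let β : ZMod ℓ → ℤ := fun t => t.val * (ℓ - t.val)
  let E : ZMod ℓ × ZMod ℓ → ℤ := fun w =>
    2 * N * ℓ ^ 2 - m₀ * (β w.1 + β (s * w.1) + β ((s + 1 : ℤ) * w.1))
  have hE : ∀ w, w ≠ 0 → E w ≤ 2 * o w := fun w hw => by
    obtain ⟨⟨n, r⟩, hp, hor⟩ := ho w hw
    obtain ⟨B, hB⟩ : ∃ B, O.valuation (a n (r - s * B) B m₀) = 1 := by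
      by_contra! hall
      refine (O.valuation.map_sum_lt one_ne_zero fun B _ => ?_).ne hp
      exact lt_of_le_of_ne (hint _ _ _ _) (hall B)
    have hmin : ∀ x y : ℤ, N ≤ n + (r - s * B) * x + B * y + m₀ * (x ^ 2 + x * y + y ^ 2) :=
      fun x y => hlow (by rw [← h.translate n (r - s * B) B m₀ x y]; exact hB)
    have key := hexagonal_interpolation_bound hmin (ℓ := ℓ) (t := w.1.val) (by positivity)
      (by exact_mod_cast ZMod.val_lt w.1) (s * w.1.val)
    have hv1 : (((s : ZMod ℓ) * w.1).val : ℤ) = (s * w.1.val) % ℓ := by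
      rw [← ZMod.val_intCast]
      push_cast
      rw [ZMod.natCast_zmod_val]
    have hv2 : ((((s + 1 : ℤ) : ZMod ℓ) * w.1).val : ℤ) = (s * w.1.val + w.1.val) % ℓ := by
      rw [← ZMod.val_intCast]
      push_cast
      rw [ZMod.natCast_zmod_val, add_one_mul]
    simp only [E, β, hv1, hv2]
    rw [hor, torsionExponent]
    linarith
  have hne1 : (s : ZMod ℓ) ≠ 0 := fun h0 => by
    rw [ZMod.intCast_zmod_eq_zero_iff_dvd] at h0
    have := Int.le_of_dvd hs0 h0
    omega
  have hne2 : ((s + 1 : ℤ) : ZMod ℓ) ≠ 0 := fun h0 => by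
    rw [ZMod.intCast_zmod_eq_zero_iff_dvd] at h0
    have := Int.le_of_dvd (by linarith) h0
    omega
  have hEsum : 2 * ∑ w ∈ (Finset.univ.erase 0 : Finset (ZMod ℓ × ZMod ℓ)), E w =
      (4 * N - m₀) * (ℓ ^ 2 * (ℓ ^ 2 - 1)) := by
    have h1 : ∑ w, E w = ℓ * (ℓ * (2 * N * ℓ ^ 2) -
        m₀ * (∑ t, β t + ∑ t, β (s * t) + ∑ t, β ((s + 1 : ℤ) * t))) := by
      rw [Fintype.sum_prod_type]
      simp only [E, Finset.sum_const, Finset.card_univ, ZMod.card, nsmul_eq_mul,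
        Finset.sum_sub_distrib, ← Finset.mul_sum, Finset.sum_add_distrib]
    have h2 : E 0 = 2 * N * ℓ ^ 2 := by simp [E, β]
    have h3 := Finset.add_sum_erase Finset.univ E (Finset.mem_univ (0 : ZMod ℓ × ZMod ℓ))
    have b1 : 6 * ∑ t, β t = (ℓ : ℤ) ^ 3 - ℓ := ZMod.six_mul_sum_val_mul_sub
    have b2 : 6 * ∑ t, β (s * t) = (ℓ : ℤ) ^ 3 - ℓ := ZMod.six_mul_sum_val_mul_sub_mul hne1
    have b3 : 6 * ∑ t, β ((s + 1 : ℤ) * t) = (ℓ : ℤ) ^ 3 - ℓ :=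
      ZMod.six_mul_sum_val_mul_sub_mul hne2
    generalize ∑ t, β t = S1 at h1 b1
    generalize ∑ t, β (s * t) = S2 at h1 b2
    generalize ∑ t, β ((s + 1 : ℤ) * t) = S3 at h1 b3
    refine mul_left_cancel₀ (show (6 : ℤ) ≠ 0 by norm_num) ?_
    have h4 : 6 * (S1 + S2 + S3) = 3 * ((ℓ : ℤ) ^ 3 - ℓ) := by linarith
    have h5 : 6 * (m₀ * ℓ * (S1 + S2 + S3)) = m₀ * ℓ * (3 * ((ℓ : ℤ) ^ 3 - ℓ)) := by
      rw [← h4]; ring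
    linarith
  have hcmp : ∑ w ∈ (Finset.univ.erase 0 : Finset (ZMod ℓ × ZMod ℓ)), E w ≤
      2 * ∑ w ∈ (Finset.univ.erase 0 : Finset (ZMod ℓ × ZMod ℓ)), (o w : ℤ) := by
    rw [Finset.mul_sum]
    exact Finset.sum_le_sum fun w hw => hE w (Finset.ne_of_mem_erase hw)
  have hpos : (0 : ℤ) < ℓ ^ 2 * (ℓ ^ 2 - 1) := by
    have : (2 : ℤ) ≤ ℓ := by exact_mod_cast hℓ.two_le
    have : (1 : ℤ) < ℓ ^ 2 := by nlinarith
    exact mul_pos (by linarith) (by linarith)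
  have hfin : (24 * N - 6 * m₀) * ((ℓ : ℤ) ^ 2 * (ℓ ^ 2 - 1)) ≤
      2 * k * ((ℓ : ℤ) ^ 2 * (ℓ ^ 2 - 1)) := by linarith
  have := le_of_mul_le_mul_right hfin hpos
  omega

end FourierJacobi

section PIntegral

/-- There is a valuation ring of `ℂ` in which the prime `p` is not a unit. -/
lemma exists_valuationSubring_natCast_lt_one {p : ℕ} (hp : p.Prime) :
    ∃ O : ValuationSubring ℂ, O.valuation (p : ℂ) < 1 := by
  let R : Subring ℂ := (Int.castRingHom ℂ).range
  let π : R := ⟨(p : ℂ), ⟨p, by simp⟩⟩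
  obtain ⟨O, -, hO⟩ := Ideal.image_subset_nonunits_valuationSubring (Ideal.span {π}) (by
    rw [Ne, Ideal.span_singleton_eq_top, isUnit_iff_exists_inv]
    rintro ⟨⟨_, n, rfl⟩, hn⟩
    have h1 : (p : ℂ) * ((n : ℤ) : ℂ) = 1 := congrArg Subtype.val hn
    have h2 : (p : ℤ) * n = 1 := by exact_mod_cast h1
    have := Int.isUnit_iff.mp (IsUnit.of_mul_eq_one _ h2)
    have := hp.two_le
    omega)
  exact ⟨O, O.mem_nonunits_iff.mp (hO ⟨π, Ideal.mem_span_singleton_self π, rfl⟩)⟩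

variable {Γ₀ : Type*} [LinearOrderedCommGroupWithZero Γ₀] {v : Valuation ℂ Γ₀} {p : ℕ}

lemma valuation_intCast_eq_one (hp : p.Prime) (hv : v p < 1) {b : ℤ} (hb : ¬ (p : ℤ) ∣ b) :
    v (b : ℂ) = 1 := by
  refine le_antisymm (valuation_intCast_le_one v b) (not_lt.mp fun hlt => ?_)
  obtain ⟨x, y, hxy⟩ := ((Nat.prime_iff_prime_int.mp hp).coprime_iff_not_dvd).mpr hb
  have h1 : (x : ℂ) * p + y * b = 1 := by exact_mod_cast hxy
  refine (v.map_add_lt (g := 1) ?_ ?_).ne (by rw [h1, map_one])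
  · rw [map_mul]
    exact (mul_le_of_le_one_left' (valuation_intCast_le_one v x)).trans_lt hv
  · rw [map_mul]
    exact (mul_le_of_le_one_left' (valuation_intCast_le_one v y)).trans_lt hlt

lemma IsPIntegral.valuation_le_one (hp : p.Prime) (hv : v p < 1) {z : ℂ} (hz : IsPIntegral p z) :
    v z ≤ 1 := by
  obtain ⟨a, b, hb, hab⟩ := hz
  have := congrArg v hab
  rw [map_mul, valuation_intCast_eq_one hp hv hb, one_mul] at this
  rw [this]
  exact valuation_intCast_le_one v a

lemma ModCongr.valuation_lt_one (hp : p.Prime) (hv : v p < 1) {z : ℂ} (hz : ModCongr p 1 z 0) :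
    v z < 1 := by
  have h1 := IsPIntegral.valuation_le_one hp hv hz
  have hp0 : (p : ℂ) ≠ 0 := by exact_mod_cast hp.ne_zero
  rw [pow_one, sub_zero] at h1
  rw [← div_mul_cancel₀ z hp0, map_mul]
  exact (mul_le_of_le_one_left' h1).trans_lt hv

lemma IsPIntegral.modCongr_zero (hp : p.Prime) (hv : v p < 1) {z : ℂ} (hz : IsPIntegral p z)
    (hz1 : v z < 1) : ModCongr p 1 z 0 := by
  obtain ⟨a, b, hb, hab⟩ := hz
  have hp0 : (p : ℂ) ≠ 0 := by exact_mod_cast hp.ne_zero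
  have ha : (p : ℤ) ∣ a := by
    by_contra ha
    have := congrArg v hab
    rw [map_mul, valuation_intCast_eq_one hp hv hb, one_mul,
      valuation_intCast_eq_one hp hv ha] at this
    exact hz1.ne this
  obtain ⟨c, rfl⟩ := ha
  refine ⟨c, b, hb, ?_⟩
  rw [pow_one, sub_zero, ← mul_div_assoc, hab]
  push_cast
  field_simp

end PIntegral

section FourierUniqueness

lemma continuous_expTwoPi_mul (z : ℂ) : Continuous fun x : ℝ => expTwoPi (z * x) := by
  unfold expTwoPi
  fun_prop

lemma integral_expTwoPi_int_mul (n : ℤ) :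
    ∫ x : ℝ in (0 : ℝ)..1, expTwoPi (n * x) = if n = 0 then 1 else 0 := by
  split_ifs with h
  · subst h
    simp [expTwoPi]
  · have hc : (2 * Real.pi * Complex.I * n : ℂ) ≠ 0 := by
      simp [h, Real.pi_ne_zero]
    have h1 : ∀ x : ℝ, expTwoPi (n * x) = cexp (2 * Real.pi * Complex.I * n * x) := fun x => by
      rw [expTwoPi, ← mul_assoc]
    simp only [h1]
    rw [integral_exp_mul_complex hc, Complex.ofReal_one, mul_one, Complex.ofReal_zero, mul_zero,
      Complex.exp_zero, show (2 * Real.pi * Complex.I * n : ℂ) = n * (2 * Real.pi * Complex.I) by ring,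
      Complex.exp_int_mul_two_pi_mul_I, sub_self, zero_div]

lemma norm_expTwoPi_int_mul (n : ℤ) (x : ℝ) : ‖expTwoPi (n * x)‖ = 1 := by
  rw [expTwoPi, show (2 * Real.pi * Complex.I * (n * x) : ℂ) =
    ((2 * Real.pi * (n * x) : ℝ) : ℂ) * Complex.I by push_cast; ring, Complex.norm_exp_ofReal_mul_I]

/-- The sub-sums of a vanishing absolutely convergent trigonometric series over each frequency
vanish. -/
lemma hasSum_frequency_eq_zero {ι : Type*} [Countable ι] {c : ι → ℂ} {n : ι → ℤ}
    (h : ∀ x : ℝ, HasSum (fun i => c i * expTwoPi (n i * x)) 0) (N : ℤ) :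
    HasSum (fun i => if n i = N then c i else 0) 0 := by
  have hc : Summable fun i => ‖c i‖ := by
    have := (h 0).summable.norm
    simpa [expTwoPi] using this
  have key := intervalIntegral.hasSum_integral_of_dominated_convergence (a := 0) (b := 1)
    (μ := MeasureTheory.volume) (F := fun i (x : ℝ) => c i * expTwoPi ((n i - N : ℤ) * x))
    (f := fun _ => 0) (fun i _ => ‖c i‖) (fun i => ?_) (fun i => ?_) ?_ ?_ ?_
  · rw [intervalIntegral.integral_zero] at key
    refine HasSum.of_term_eq key fun i => ?_
    rw [intervalIntegral.integral_const_mul, integral_expTwoPi_int_mul]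
    simp [sub_eq_zero]
  · exact (continuous_const.mul (continuous_expTwoPi_mul _)).aestronglyMeasurable
  · refine Filter.Eventually.of_forall fun x _ => ?_
    rw [norm_mul, norm_expTwoPi_int_mul, mul_one]
  · exact Filter.Eventually.of_forall fun x _ => hc
  · exact intervalIntegrable_const
  · refine Filter.Eventually.of_forall fun x _ => ?_
    have := (h x).mul_right (expTwoPi (-N * x))
    rw [zero_mul] at this
    refine HasSum.of_term_eq this fun i => ?_
    rw [mul_assoc, ← expTwoPi_add]
    congr 2
    push_cast
    ring

/-- Uniqueness of the coefficients of absolutely convergent Fourier series in four variables. -/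
lemma fourier_four_unique {c : ℤ × ℤ × ℤ × ℤ → ℂ}
    (h : ∀ x₁ x₂ x₃ x₄ : ℝ, HasSum (fun p : ℤ × ℤ × ℤ × ℤ =>
      c p * expTwoPi (p.1 * x₁ + p.2.1 * x₂ + p.2.2.1 * x₃ + p.2.2.2 * x₄)) 0)
    (q : ℤ × ℤ × ℤ × ℤ) : c q = 0 := by
  have h1 : ∀ x₂ x₃ x₄ : ℝ, HasSum (fun p : ℤ × ℤ × ℤ × ℤ => (if p.1 = q.1 then c p else 0) *
      expTwoPi (p.2.1 * x₂ + p.2.2.1 * x₃ + p.2.2.2 * x₄)) 0 := fun x₂ x₃ x₄ => by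
    refine HasSum.of_term_eq (hasSum_frequency_eq_zero (n := fun p : ℤ × ℤ × ℤ × ℤ => p.1)
      (c := fun p => c p * expTwoPi (p.2.1 * x₂ + p.2.2.1 * x₃ + p.2.2.2 * x₄))
      (fun x₁ => HasSum.of_term_eq (h x₁ x₂ x₃ x₄) fun p => ?_) q.1) fun p => (ite_zero_mul _ _ _)
    rw [mul_assoc, ← expTwoPi_add]
    congr 2
    ring
  have h2 : ∀ x₃ x₄ : ℝ, HasSum (fun p : ℤ × ℤ × ℤ × ℤ =>
      (if p.2.1 = q.2.1 then (if p.1 = q.1 then c p else 0) else 0) *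
      expTwoPi (p.2.2.1 * x₃ + p.2.2.2 * x₄)) 0 := fun x₃ x₄ => by
    refine HasSum.of_term_eq (hasSum_frequency_eq_zero (n := fun p : ℤ × ℤ × ℤ × ℤ => p.2.1)
      (c := fun p => (if p.1 = q.1 then c p else 0) * expTwoPi (p.2.2.1 * x₃ + p.2.2.2 * x₄))
      (fun x₁ => HasSum.of_term_eq (h1 x₁ x₃ x₄) fun p => ?_) q.2.1) fun p => (ite_zero_mul _ _ _)
    rw [mul_assoc, ← expTwoPi_add]
    congr 2
    ring
  have h3 : ∀ x₄ : ℝ, HasSum (fun p : ℤ × ℤ × ℤ × ℤ => (if p.2.2.1 = q.2.2.1 then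
      (if p.2.1 = q.2.1 then (if p.1 = q.1 then c p else 0) else 0) else 0) *
      expTwoPi (p.2.2.2 * x₄)) 0 := fun x₄ => by
    refine HasSum.of_term_eq (hasSum_frequency_eq_zero (n := fun p : ℤ × ℤ × ℤ × ℤ => p.2.2.1)
      (c := fun p => (if p.2.1 = q.2.1 then (if p.1 = q.1 then c p else 0) else 0) *
        expTwoPi (p.2.2.2 * x₄))
      (fun x₁ => HasSum.of_term_eq (h2 x₁ x₄) fun p => ?_) q.2.2.1) fun p =>
        (ite_zero_mul _ _ _)
    rw [mul_assoc, ← expTwoPi_add]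
    congr 2
    ring
  have h4 := hasSum_frequency_eq_zero h3 q.2.2.2
  refine (HasSum.of_term_eq (hasSum_ite_eq q (c q)) fun p => ?_).unique h4
  by_cases hp : p = q
  · simp [hp]
  · rw [if_neg hp]
    have : ¬ (p.1 = q.1 ∧ p.2.1 = q.2.1 ∧ p.2.2.1 = q.2.2.1 ∧ p.2.2.2 = q.2.2.2) := fun h =>
      hp (by ext <;> simp [h])
    split_ifs <;> first | rfl | (exfalso; tauto)

end FourierUniqueness

section HexagonalForms

open UpperHalfPlane

/-- The coordinates `(τ, z₁, z₂, τ')` of points of the Hermitian upper half-space of degree two over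
the hexagonal lattice. -/
def HexDomain (τ z₁ z₂ τ' : ℂ) : Prop :=
  0 < τ.im ∧ z₁.im ^ 2 + z₁.im * z₂.im + z₂.im ^ 2 < τ.im * τ'.im

/-- The exponent of the Fourier index `(n, A, B, m)` at `(τ, z₁, z₂, τ')`. -/
def hexPairing (p : ℤ × ℤ × ℤ × ℤ) (τ z₁ z₂ τ' : ℂ) : ℂ :=
  p.1 * τ + p.2.1 * z₁ + p.2.2.1 * z₂ + p.2.2.2 * τ'

/-- Hermitian modular forms over the hexagonal lattice in coordinates: the Fourier expansion together
with the transformation laws used in the theory of Fourier-Jacobi coefficients. -/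
structure IsHexagonalForm (k : ℤ) (a : ℤ → ℤ → ℤ → ℤ → ℂ) (F : ℂ → ℂ → ℂ → ℂ → ℂ) : Prop where
  support : ∀ n A B m, a n A B m ≠ 0 → 0 ≤ n ∧ 0 ≤ m ∧ A ^ 2 - A * B + B ^ 2 ≤ 3 * (n * m)
  expansion : ∀ τ z₁ z₂ τ', HexDomain τ z₁ z₂ τ' → HasSum (fun p : ℤ × ℤ × ℤ × ℤ =>
    a p.1 p.2.1 p.2.2.1 p.2.2.2 * expTwoPi (hexPairing p τ z₁ z₂ τ')) (F τ z₁ z₂ τ')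
  translate : ∀ τ z₁ z₂ τ', HexDomain τ z₁ z₂ τ' → ∀ x y : ℤ,
    F τ (z₁ + x * τ) (z₂ + y * τ)
      (τ' + (x ^ 2 + x * y + y ^ 2) * τ + (2 * x + y) * z₁ + (x + 2 * y) * z₂) = F τ z₁ z₂ τ'
  swap : ∀ τ z₁ z₂ τ', HexDomain τ z₁ z₂ τ' → F τ' (-(z₁ + z₂)) z₂ τ = F τ z₁ z₂ τ'
  inversion : ∀ τ z₁ z₂ τ', HexDomain τ z₁ z₂ τ' →
    F (-1 / τ) (z₁ / τ) (z₂ / τ) (τ' - (z₁ ^ 2 + z₁ * z₂ + z₂ ^ 2) / τ) = τ ^ k * F τ z₁ z₂ τ'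

/-- The action of a unipotent translation on Fourier indices with fixed last component `m`. -/
def hexTranslate (m x y : ℤ) : ℤ × ℤ × ℤ ≃ ℤ × ℤ × ℤ where
  toFun p := (p.1 + p.2.1 * x + p.2.2 * y + m * (x ^ 2 + x * y + y ^ 2),
    p.2.1 + m * (2 * x + y), p.2.2 + m * (x + 2 * y))
  invFun p := (p.1 - p.2.1 * x - p.2.2 * y + m * (x ^ 2 + x * y + y ^ 2),
    p.2.1 - m * (2 * x + y), p.2.2 - m * (x + 2 * y))
  left_inv p := by ext <;> dsimp only <;> ring
  right_inv p := by ext <;> dsimp only <;> ring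

/-- The action of a unipotent translation on Fourier indices. -/
def hexTranslateFull (x y : ℤ) : ℤ × ℤ × ℤ × ℤ ≃ ℤ × ℤ × ℤ × ℤ where
  toFun p := (p.1 + p.2.1 * x + p.2.2.1 * y + p.2.2.2 * (x ^ 2 + x * y + y ^ 2),
    p.2.1 + p.2.2.2 * (2 * x + y), p.2.2.1 + p.2.2.2 * (x + 2 * y), p.2.2.2)
  invFun p := (p.1 - p.2.1 * x - p.2.2.1 * y + p.2.2.2 * (x ^ 2 + x * y + y ^ 2),
    p.2.1 - p.2.2.2 * (2 * x + y), p.2.2.1 - p.2.2.2 * (x + 2 * y), p.2.2.2)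
  left_inv p := by ext <;> dsimp only <;> ring
  right_inv p := by ext <;> dsimp only <;> ring

/-- The action of the exchange of the diagonal entries on Fourier indices. -/
def hexSwap : ℤ × ℤ × ℤ × ℤ ≃ ℤ × ℤ × ℤ × ℤ where
  toFun p := (p.2.2.2, -p.2.1, p.2.2.1 - p.2.1, p.1)
  invFun p := (p.2.2.2, -p.2.1, p.2.2.1 - p.2.1, p.1)
  left_inv p := by ext <;> dsimp only <;> ring
  right_inv p := by ext <;> dsimp only <;> ring

lemma coeff_eq_of_hexPairing_equiv {b : ℤ × ℤ × ℤ × ℤ → ℂ} (σ : ℤ × ℤ × ℤ × ℤ ≃ ℤ × ℤ × ℤ × ℤ)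
    (h : ∀ x₁ x₂ x₃ x₄ : ℝ, ∃ S,
      HasSum (fun p => b p * expTwoPi (hexPairing p (x₁ + Complex.I) x₂ x₃ (x₄ + Complex.I))) S ∧
      HasSum (fun p => b p * expTwoPi (hexPairing (σ p) (x₁ + Complex.I) x₂ x₃ (x₄ + Complex.I))) S)
    (p : ℤ × ℤ × ℤ × ℤ) : b p = b (σ p) := by
  have key := fourier_four_unique
    (c := fun q => (b q - b (σ.symm q)) * expTwoPi (hexPairing q Complex.I 0 0 Complex.I))
    (fun x₁ x₂ x₃ x₄ => ?_) (σ p)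
  · have := (mul_eq_zero.mp key).resolve_right (expTwoPi_ne_zero _)
    rw [Equiv.symm_apply_apply] at this
    exact (sub_eq_zero.mp this).symm
  · obtain ⟨S, h1, h2⟩ := h x₁ x₂ x₃ x₄
    rw [← σ.symm.hasSum_iff] at h2
    have h3 := h1.sub h2
    rw [sub_self] at h3
    refine HasSum.of_term_eq h3 fun q => ?_
    simp only [Function.comp_apply, Equiv.apply_symm_apply]
    rw [← sub_mul, mul_assoc, ← expTwoPi_add]
    congr 2
    simp only [hexPairing]
    ring

/-- The restriction of the `m`-th Fourier-Jacobi coefficient to the line spanned by `(1, s)`. -/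
def lineFun (a : ℤ → ℤ → ℤ → ℤ → ℂ) (m s : ℤ) (τ : ℍ) (z : ℂ) : ℂ :=
  ∑' p : ℤ × ℤ × ℤ, a p.1 p.2.1 p.2.2 m * expTwoPi (p.1 * τ + (p.2.1 + s * p.2.2) * z)

namespace IsHexagonalForm

variable {k : ℤ} {a : ℤ → ℤ → ℤ → ℤ → ℂ} {F : ℂ → ℂ → ℂ → ℂ → ℂ}

lemma isHexagonalExpansion (h : IsHexagonalForm k a F) : IsHexagonalExpansion a where
  support := h.support
  translate n A B m x y := by
    refine coeff_eq_of_hexPairing_equiv (b := fun p => a p.1 p.2.1 p.2.2.1 p.2.2.2)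
      (hexTranslateFull x y) (fun x₁ x₂ x₃ x₄ => ?_) (n, A, B, m)
    have hD : HexDomain (x₁ + Complex.I) x₂ x₃ (x₄ + Complex.I) := by simp [HexDomain]
    refine ⟨_, h.expansion _ _ _ _ hD, ?_⟩
    rw [← h.translate _ _ _ _ hD x y]
    refine HasSum.of_term_eq (h.expansion _ _ _ _ ?_) fun p => ?_
    · have him : ((x₄ : ℂ) + Complex.I + ((x : ℂ) ^ 2 + x * y + y ^ 2) * (x₁ + Complex.I) +
          (2 * x + y) * x₂ + (x + 2 * y) * x₃).im = 1 + ((x : ℝ) ^ 2 + x * y + y ^ 2) := by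
        simp [pow_two]
      refine ⟨by simp, ?_⟩
      rw [him]
      simp
    · congr 2
      simp only [hexPairing, hexTranslateFull, Equiv.coe_fn_mk]
      push_cast
      ring
  swap n A B m := by
    refine coeff_eq_of_hexPairing_equiv (b := fun p => a p.1 p.2.1 p.2.2.1 p.2.2.2)
      hexSwap (fun x₁ x₂ x₃ x₄ => ?_) (n, A, B, m)
    have hD : HexDomain (x₁ + Complex.I) x₂ x₃ (x₄ + Complex.I) := by simp [HexDomain]
    refine ⟨_, h.expansion _ _ _ _ hD, ?_⟩
    rw [← h.swap _ _ _ _ hD]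
    refine HasSum.of_term_eq (h.expansion _ _ _ _ ?_) fun p => ?_
    · simp [HexDomain]
    · congr 2
      simp only [hexPairing, hexSwap, Equiv.coe_fn_mk]
      push_cast
      ring

lemma hasSum_lineFun (h : IsHexagonalForm k a F) (m s : ℤ) (τ : ℍ) (z : ℂ) :
    HasSum (fun p : ℤ × ℤ × ℤ =>
      a p.1 p.2.1 p.2.2 m * expTwoPi (p.1 * τ + (p.2.1 + s * p.2.2) * z)) (lineFun a m s τ z) := by
  refine Summable.hasSum ?_
  obtain ⟨Y, hY⟩ := exists_gt ((z.im ^ 2 + z.im * (s * z).im + (s * z).im ^ 2) / τ.im)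
  have hD : HexDomain τ z (s * z) (Y * Complex.I) := by
    refine ⟨τ.im_pos, ?_⟩
    rw [div_lt_iff₀ τ.im_pos] at hY
    simpa [mul_comm] using hY
  have hinj : Function.Injective fun p : ℤ × ℤ × ℤ => (p.1, p.2.1, p.2.2, m) := by
    rintro ⟨_, _, _⟩ ⟨_, _, _⟩ hp
    simpa using hp
  have h1 := ((h.expansion _ _ _ _ hD).summable.comp_injective hinj).mul_right
    (expTwoPi (-(m * (Y * Complex.I))))
  refine h1.congr fun p => ?_
  simp only [Function.comp_apply]
  rw [mul_assoc, ← expTwoPi_add]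
  congr 2
  simp only [hexPairing]
  ring

lemma lineFun_elliptic (h : IsHexagonalForm k a F) (m s : ℤ) (τ : ℍ) (z : ℂ) (x b : ℤ) :
    lineFun a m s τ (z + x * τ + b) =
      expTwoPi (-(m * (1 + s + s ^ 2) : ℤ) * (x ^ 2 * τ + 2 * x * z)) * lineFun a m s τ z := by
  have hsum := (((hexTranslate m x (s * x)).hasSum_iff.mpr (h.hasSum_lineFun m s τ z)).mul_left
    (expTwoPi (-(m * (1 + s + s ^ 2) : ℤ) * (x ^ 2 * τ + 2 * x * z))))
  refine (h.hasSum_lineFun m s τ _).unique (HasSum.of_term_eq hsum fun p => ?_)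
  simp only [Function.comp_apply]
  have e : (p.1 * τ + (p.2.1 + s * p.2.2) * (z + x * τ + b) : ℂ) =
      -(m * (1 + s + s ^ 2) : ℤ) * (x ^ 2 * τ + 2 * x * z) +
      ((hexTranslate m x (s * x) p).1 * τ + ((hexTranslate m x (s * x) p).2.1 +
        s * (hexTranslate m x (s * x) p).2.2) * z) + ((p.2.1 + s * p.2.2) * b : ℤ) := by
    simp only [hexTranslate, Equiv.coe_fn_mk]
    push_cast
    ring
  rw [e, expTwoPi_add, expTwoPi_int, mul_one, expTwoPi_add, mul_left_comm,
    h.isHexagonalExpansion.translate p.1 p.2.1 p.2.2 m x (s * x)]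
  rfl

lemma lineFun_inversion (h : IsHexagonalForm k a F) (m s : ℤ) (τ : ℍ) (z : ℂ) :
    lineFun a m s (ModularGroup.S • τ) (z / τ) =
      (τ : ℂ) ^ k * expTwoPi ((m * (1 + s + s ^ 2) : ℤ) * z ^ 2 / τ) * lineFun a m s τ z := by
  have hS : ((ModularGroup.S • τ : ℍ) : ℂ) = -1 / τ := by
    rw [modular_S_smul]; simp [neg_div]
  have hS0 : 0 < (-1 / τ : ℂ).im := by rw [← hS]; exact (ModularGroup.S • τ).im_pos
  let w : ℂ := (z ^ 2 + z * (s * z) + (s * z) ^ 2) / τ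
  obtain ⟨Y, hY⟩ := exists_gt (max
    ((z.im ^ 2 + z.im * (s * z).im + (s * z).im ^ 2) / τ.im)
    (((z / τ).im ^ 2 + (z / τ).im * (s * z / τ).im + (s * z / τ).im ^ 2) / (-1 / τ : ℂ).im + w.im))
  obtain ⟨hY1, hY2⟩ := max_lt_iff.mp hY
  have hD1 : ∀ x : ℝ, HexDomain τ z (s * z) (x + Y * Complex.I) := fun x => by
    refine ⟨τ.im_pos, ?_⟩
    rw [div_lt_iff₀ τ.im_pos] at hY1
    simpa [mul_comm] using hY1
  have hD2 : ∀ x : ℝ, HexDomain (-1 / τ) (z / τ) (s * z / τ) (x + Y * Complex.I - w) := fun x => by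
    refine ⟨hS0, ?_⟩
    rw [← lt_sub_iff_add_lt, div_lt_iff₀ hS0] at hY2
    have him : (x + Y * Complex.I - w).im = Y - w.im := by simp
    rw [him]
    linarith
  have hinj : Function.Injective fun p : ℤ × ℤ × ℤ => (p.1, p.2.1, p.2.2, m) := by
    rintro ⟨_, _, _⟩ ⟨_, _, _⟩ hp
    simpa using hp
  have hzero : ∀ x : ℝ, HasSum (fun p : ℤ × ℤ × ℤ × ℤ => (a p.1 p.2.1 p.2.2.1 p.2.2.2 *
      (expTwoPi (hexPairing p (-1 / τ) (z / τ) (s * z / τ) (Y * Complex.I - w)) -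
        (τ : ℂ) ^ k * expTwoPi (hexPairing p τ z (s * z) (Y * Complex.I)))) *
      expTwoPi (p.2.2.2 * x)) 0 := fun x => by
    have h1 := h.expansion _ _ _ _ (hD2 x)
    rw [h.inversion _ _ _ _ (hD1 x)] at h1
    have h2 := h1.sub ((h.expansion _ _ _ _ (hD1 x)).mul_left ((τ : ℂ) ^ k))
    rw [sub_self] at h2
    refine HasSum.of_term_eq h2 fun p => ?_
    have e1 : hexPairing p (-1 / τ) (z / τ) (s * z / τ) (x + Y * Complex.I - w) =
        hexPairing p (-1 / τ) (z / τ) (s * z / τ) (Y * Complex.I - w) + p.2.2.2 * x := by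
      simp only [hexPairing]; ring
    have e2 : hexPairing p τ z (s * z) (x + Y * Complex.I) =
        hexPairing p τ z (s * z) (Y * Complex.I) + p.2.2.2 * x := by
      simp only [hexPairing]; ring
    rw [e1, e2, expTwoPi_add, expTwoPi_add]
    ring
  have hm := hasSum_frequency_eq_zero hzero m
  rw [← hinj.hasSum_iff (fun p hp => if_neg fun hpm => hp ⟨(p.1, p.2.1, p.2.2.1), by
    rw [← hpm]⟩)] at hm
  have hline := (((h.hasSum_lineFun m s (ModularGroup.S • τ) (z / τ)).mul_left
    (expTwoPi (-(m * w)))).sub ((h.hasSum_lineFun m s τ z).mul_left ((τ : ℂ) ^ k))).mul_left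
    (expTwoPi (m * (Y * Complex.I)))
  have hval := hline.unique (HasSum.of_term_eq hm fun p => by
    simp only [Function.comp_apply, if_true]
    have e1 : hexPairing (p.1, p.2.1, p.2.2, m) (-1 / τ) (z / τ) (s * z / τ) (Y * Complex.I - w) =
        m * (Y * Complex.I) + (-(m * w) + (p.1 * (-1 / τ) + (p.2.1 + s * p.2.2) * (z / τ))) := by
      simp only [hexPairing]; ring
    have e2 : hexPairing (p.1, p.2.1, p.2.2, m) τ z (s * z) (Y * Complex.I) =
        m * (Y * Complex.I) + (p.1 * τ + (p.2.1 + s * p.2.2) * z) := by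
      simp only [hexPairing]; ring
    rw [e1, e2, expTwoPi_add (m * (Y * Complex.I)) (-(m * w) + _), expTwoPi_add (-(m * w)),
      expTwoPi_add (m * (Y * Complex.I)), hS]
    ring)
  have := sub_eq_zero.mp ((mul_eq_zero.mp hval).resolve_left (expTwoPi_ne_zero _))
  have hw : ((m * (1 + s + s ^ 2) : ℤ) * z ^ 2 / τ : ℂ) = m * w := by
    simp only [w]; push_cast; ring
  rw [hw, mul_right_comm, ← this, mul_comm, ← mul_assoc, ← expTwoPi_add, add_neg_cancel]
  simp [expTwoPi]

/-- The restrictions of the Fourier-Jacobi coefficients to lines are Jacobi forms. -/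
lemma isJacobiForm (h : IsHexagonalForm k a F) {m : ℤ} (hm : 0 ≤ m) (s : ℤ) :
    IsJacobiForm k (m * (1 + s + s ^ 2)) (lineCoeff a m s) (lineFun a m s) where
  index_nonneg := mul_nonneg hm (by nlinarith [sq_nonneg (s + 1), sq_nonneg s])
  support p hp := by
    obtain ⟨B, -, hB⟩ := Finset.exists_ne_zero_of_sum_ne_zero hp
    obtain ⟨h1, -, h2⟩ := h.support _ _ _ _ hB
    refine ⟨h1, ?_⟩
    have hs : 0 ≤ 1 + s + s ^ 2 := by nlinarith [sq_nonneg (s + 1), sq_nonneg s]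
    have h3 := mul_le_mul_of_nonneg_right h2 hs
    nlinarith [sq_nonneg ((1 + 2 * s) * (p.2 - s * B) - (2 + s) * B)]
  expansion τ z := by
    let σ : (ℤ × ℤ) × ℤ ≃ ℤ × ℤ × ℤ :=
      { toFun := fun q => (q.1.1, q.1.2 - s * q.2, q.2)
        invFun := fun q => ((q.1, q.2.1 + s * q.2.2), q.2.2)
        left_inv := fun q => by ext <;> simp
        right_inv := fun q => by ext <;> simp }
    refine (σ.hasSum_iff.mpr (h.hasSum_lineFun m s τ z)).prod_fiberwise fun p => ?_
    rw [lineCoeff, Finset.sum_mul]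
    refine HasSum.of_term_eq (g := fun B => a p.1 (p.2 - s * B) B m *
      expTwoPi (p.1 * τ + p.2 * z)) (hasSum_sum_of_ne_finset_zero fun B hB => ?_) fun B => ?_
    · by_contra hne
      have := (h.isHexagonalExpansion.abs_le (left_ne_zero_of_mul hne)).2
      exact hB (Finset.mem_Icc.mpr (abs_le.mp this))
    · simp [σ]
  inversion := h.lineFun_inversion m s
  elliptic τ z x b := h.lineFun_elliptic m s τ z x b

end IsHexagonalForm

end HexagonalForms

section HermitianBridge

/-- The primitive sixth root of unity `(1 + √-3) / 2`. -/
def hexRoot : ℂ := (1 + sqrtD (-3)) / 2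

lemma sqrtD_neg_three_sq : sqrtD (-3) ^ 2 = -3 := by
  rw [sqrtD, mul_pow, Complex.I_sq, ← Complex.ofReal_pow, Real.sq_sqrt (by norm_num)]
  push_cast
  ring

lemma sqrtD_neg_three_ne_zero : sqrtD (-3) ≠ 0 := fun h => by
  have := sqrtD_neg_three_sq
  rw [h] at this
  norm_num at this

lemma star_sqrtD (d : ℤ) : star (sqrtD d) = -sqrtD d := by
  simp [sqrtD]

lemma hexRoot_sq : hexRoot ^ 2 = hexRoot - 1 := by
  rw [hexRoot]
  linear_combination (1 / 4 : ℂ) * sqrtD_neg_three_sq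

lemma star_hexRoot : star hexRoot = 1 - hexRoot := by
  simp only [hexRoot, star_div₀, star_add, star_one, star_sqrtD, star_ofNat]
  ring

lemma sqrtD_neg_three_eq : sqrtD (-3) = 2 * hexRoot - 1 := by
  rw [hexRoot]
  ring

lemma add_mul_hexRoot_mem_ringInt (x y : ℤ) : (x + y * hexRoot : ℂ) ∈ ringInt (-3) :=
  ⟨x + 2 * y, y, by rw [hexRoot]; push_cast; ring⟩

lemma intCast_mem_ringInt (d x : ℤ) : (x : ℂ) ∈ ringInt d :=
  ⟨x, 0, by simp⟩

/-- The element of the inverse different with hexagonal coordinates `(A, B)`. -/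
def hexElement (A B : ℤ) : ℂ := ((2 * A - B) + (2 * B - A) * hexRoot) / 3

lemma star_hexElement (A B : ℤ) :
    star (hexElement A B) = ((2 * A - B) + (2 * B - A) * (1 - hexRoot)) / 3 := by
  simp [hexElement, ← star_hexRoot]

lemma sqrtD_mul_hexElement (A B : ℤ) :
    sqrtD (-3) * hexElement A B = ((-B : ℤ) : ℂ) + A * hexRoot := by
  rw [sqrtD_neg_three_eq, hexElement]
  push_cast
  linear_combination (2 * (2 * B - A) / 3 : ℂ) * hexRoot_sq

lemma hexElement_mem_invDiff (A B : ℤ) : hexElement A B ∈ invDiff (-3) := by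
  rw [invDiff, Set.mem_ofPred_eq, sqrtD_mul_hexElement]
  exact add_mul_hexRoot_mem_ringInt _ _

lemma exists_eq_hexElement {z : ℂ} (hz : z ∈ invDiff (-3)) : ∃ A B : ℤ, z = hexElement A B := by
  obtain ⟨a, b, hab⟩ := hz
  refine ⟨b, 2 * b - a, mul_left_cancel₀ sqrtD_neg_three_ne_zero ?_⟩
  rw [hab, sqrtD_mul_hexElement, hexRoot]
  push_cast
  ring

lemma normSq_hexElement (A B : ℤ) :
    Complex.normSq (hexElement A B) = ((A : ℝ) ^ 2 - A * B + B ^ 2) / 3 := by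
  have h : ((Complex.normSq (hexElement A B) : ℝ) : ℂ) =
      (((A : ℝ) ^ 2 - A * B + B ^ 2) / 3 : ℝ) := by
    rw [Complex.normSq_eq_conj_mul_self, starRingEnd_apply, star_hexElement, hexElement]
    push_cast
    linear_combination (-(2 * B - A) ^ 2 / 9 : ℂ) * hexRoot_sq
  exact_mod_cast h

/-- The Hermitian matrix with hexagonal coordinates `(n, A, B, m)`. -/
def hexMatrix (p : ℤ × ℤ × ℤ × ℤ) : Matrix (Fin 2) (Fin 2) ℂ :=
  !![(p.1 : ℂ), hexElement p.2.1 p.2.2.1; (starRingEnd ℂ) (hexElement p.2.1 p.2.2.1), (p.2.2.2 : ℂ)]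

/-- The matrix with coordinates `(τ, z₁, z₂, τ')`. -/
def hexPoint (τ z₁ z₂ τ' : ℂ) : Matrix (Fin 2) (Fin 2) ℂ :=
  !![τ, z₁ + z₂ * hexRoot; z₁ + z₂ * (1 - hexRoot), τ']

lemma trace_hexMatrix_mul_hexPoint (p : ℤ × ℤ × ℤ × ℤ) (τ z₁ z₂ τ' : ℂ) :
    (hexMatrix p * hexPoint τ z₁ z₂ τ').trace = hexPairing p τ z₁ z₂ τ' := by
  rw [hexMatrix, hexPoint, hexPairing, starRingEnd_apply, star_hexElement, hexElement,
    Matrix.trace_fin_two]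
  simp only [Matrix.mul_apply, Fin.sum_univ_two, Matrix.of_apply, Matrix.cons_val', Matrix.cons_val_zero,
    Matrix.cons_val_one, Matrix.cons_val_fin_one]
  linear_combination (-(2 * (2 * p.2.2.1 - p.2.1)) * z₂ / 3 : ℂ) * hexRoot_sq

lemma hexElement_injective {A B A' B' : ℤ} (h : hexElement A B = hexElement A' B') :
    A = A' ∧ B = B' := by
  have h1 : hexElement A B + star (hexElement A B) = A := by
    rw [star_hexElement, hexElement]; ring
  have h1' : hexElement A' B' + star (hexElement A' B') = A' := by
    rw [star_hexElement, hexElement]; ring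
  have hA : A = A' := by
    rw [h, h1'] at h1
    exact_mod_cast h1.symm
  subst hA
  have h2 := congrArg (sqrtD (-3) * ·) h
  simp only [sqrtD_mul_hexElement, add_left_inj, Int.cast_inj] at h2
  exact ⟨rfl, neg_injective h2⟩

lemma hexMatrix_injective : Function.Injective hexMatrix := by
  rintro ⟨n, A, B, m⟩ ⟨n', A', B', m'⟩ h
  have h00 : (n : ℂ) = n' := congrFun (congrFun h 0) 0
  have h01 : hexElement A B = hexElement A' B' := congrFun (congrFun h 0) 1
  have h11 : (m : ℂ) = m' := congrFun (congrFun h 1) 1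
  obtain ⟨hA, hB⟩ := hexElement_injective h01
  rw [Int.cast_injective h00, Int.cast_injective h11, hA, hB]

lemma exists_eq_hexMatrix {H : Matrix (Fin 2) (Fin 2) ℂ} (hH : H ∈ HermLattice (-3)) :
    ∃ p, H = hexMatrix p := by
  obtain ⟨⟨hherm, hdiag, hoff⟩, -⟩ := hH
  obtain ⟨n, hn⟩ := hdiag 0
  obtain ⟨m, hm⟩ := hdiag 1
  obtain ⟨A, B, hAB⟩ := exists_eq_hexElement (hoff 0 1)
  refine ⟨(n, A, B, m), ?_⟩
  ext i j
  fin_cases i <;> fin_cases j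
  · simpa [hexMatrix] using hn
  · simpa [hexMatrix] using hAB
  · simpa [hexMatrix, ← hAB] using (hherm.apply 1 0).symm
  · simpa [hexMatrix] using hm

lemma hexMatrix_posSemidef {n A B m : ℤ} (h : (hexMatrix (n, A, B, m)).PosSemidef) :
    0 ≤ n ∧ 0 ≤ m ∧ A ^ 2 - A * B + B ^ 2 ≤ 3 * (n * m) := by
  have h0 : (0 : ℂ) ≤ n := h.diag_nonneg (i := 0)
  have h1 : (0 : ℂ) ≤ m := h.diag_nonneg (i := 1)
  have hd := h.det_nonneg
  rw [hexMatrix, Matrix.det_fin_two_of, mul_comm (hexElement A B), ← Complex.normSq_eq_conj_mul_self,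
    normSq_hexElement] at hd
  have hd' : (0 : ℝ) ≤ n * m - ((A : ℝ) ^ 2 - A * B + B ^ 2) / 3 := by exact_mod_cast hd
  refine ⟨by exact_mod_cast h0, by exact_mod_cast h1, ?_⟩
  have : ((A : ℝ) ^ 2 - A * B + B ^ 2) ≤ 3 * (n * m) := by linarith
  exact_mod_cast this

lemma posDef_fin_two {a d : ℝ} {b : ℂ} (ha : 0 < a) (hdet : Complex.normSq b < a * d) :
    (!![(a : ℂ), b; star b, (d : ℂ)]).PosDef := by
  refine Matrix.PosDef.of_dotProduct_mulVec_pos ?_ fun x hx => ?_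
  · ext i j
    fin_cases i <;> fin_cases j <;> simp
  · have key : star x ⬝ᵥ (!![(a : ℂ), b; star b, (d : ℂ)] *ᵥ x) =
        (((Complex.normSq (a * x 0 + b * x 1) +
          (a * d - Complex.normSq b) * Complex.normSq (x 1)) / a : ℝ) : ℂ) := by
      have ha' : (a : ℂ) ≠ 0 := by exact_mod_cast ha.ne'
      push_cast
      rw [eq_div_iff ha']
      simp only [Complex.normSq_eq_conj_mul_self, dotProduct, Matrix.mulVec, Fin.sum_univ_two,
        Matrix.of_apply, Matrix.cons_val', Matrix.cons_val_zero, Matrix.cons_val_one,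
        Matrix.cons_val_fin_one, Pi.star_apply, map_add, map_mul, Complex.conj_ofReal,
        RCLike.star_def]
      ring
    rw [key]
    refine Complex.zero_lt_real.mpr (div_pos ?_ ha)
    by_cases h1 : x 1 = 0
    · have h0 : x 0 ≠ 0 := fun h0 => hx (by ext i; fin_cases i <;> simp [h0, h1])
      have : 0 < Complex.normSq (a * x 0) :=
        Complex.normSq_pos.mpr (mul_ne_zero (by exact_mod_cast ha.ne') h0)
      simpa [h1] using this
    · exact add_pos_of_nonneg_of_pos (Complex.normSq_nonneg _)
        (mul_pos (sub_pos.mpr hdet) (Complex.normSq_pos.mpr h1))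

lemma normSq_add_mul_hexRoot (x y : ℝ) :
    Complex.normSq (x + y * hexRoot) = x ^ 2 + x * y + y ^ 2 := by
  have h : ((Complex.normSq (x + y * hexRoot) : ℝ) : ℂ) = (x ^ 2 + x * y + y ^ 2 : ℝ) := by
    rw [Complex.normSq_eq_conj_mul_self, starRingEnd_apply]
    simp only [star_add, star_mul', star_hexRoot, RCLike.star_def, Complex.conj_ofReal]
    push_cast
    linear_combination (-y ^ 2 : ℂ) * hexRoot_sq
  exact_mod_cast h

lemma hexPoint_mem {τ z₁ z₂ τ' : ℂ} (h : HexDomain τ z₁ z₂ τ') :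
    hexPoint τ z₁ z₂ τ' ∈ HermitianUpperHalfSpace := by
  have hsub : ∀ z : ℂ, z - star z = z.im * (2 * Complex.I) := fun z => by
    rw [RCLike.star_def, Complex.sub_conj]; push_cast; ring
  have hI : (2 * Complex.I : ℂ) ≠ 0 := by simp
  have hst : star (1 - hexRoot) = hexRoot := by rw [star_sub, star_one, star_hexRoot]; ring
  rw [HermitianUpperHalfSpace, Set.mem_ofPred_eq]
  have heq : (hexPoint τ z₁ z₂ τ' - (hexPoint τ z₁ z₂ τ')ᴴ).map (fun w => w / (2 * Complex.I)) =
      !![(τ.im : ℂ), z₁.im + z₂.im * hexRoot; star (z₁.im + z₂.im * hexRoot : ℂ), (τ'.im : ℂ)] := by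
    have h1 := hsub z₁
    have h2 := hsub z₂
    ext i j
    rw [Matrix.map_apply, div_eq_iff hI, Matrix.sub_apply, Matrix.conjTranspose_apply]
    fin_cases i <;> fin_cases j
    · exact hsub τ
    · change z₁ + z₂ * hexRoot - star (z₁ + z₂ * (1 - hexRoot)) =
        (z₁.im + z₂.im * hexRoot) * (2 * Complex.I)
      rw [star_add, star_mul', hst]
      linear_combination h1 + hexRoot * h2
    · change z₁ + z₂ * (1 - hexRoot) - star (z₁ + z₂ * hexRoot) =
        star (z₁.im + z₂.im * hexRoot : ℂ) * (2 * Complex.I)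
      simp only [star_add, star_mul', star_hexRoot, RCLike.star_def, Complex.conj_ofReal] at h1 h2 ⊢
      linear_combination h1 + (1 - hexRoot) * h2
    · exact hsub τ'
  rw [heq]
  exact posDef_fin_two h.1 (by rw [normSq_add_mul_hexRoot]; exact h.2)

end HermitianBridge

section HermitianTransformations

namespace HermitianModularForm

lemma fromBlocks_diagonal_mem {d : ℤ} {U V : Matrix (Fin 2) (Fin 2) ℂ}
    (hU : ∀ i j, U i j ∈ ringInt d) (hV : ∀ i j, V i j ∈ ringInt d) (h : Uᴴ * V = 1) :
    Matrix.fromBlocks U 0 0 V ∈ HermitianModularGroup d := by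
  have h0 : (0 : ℂ) ∈ ringInt d := by simpa using intCast_mem_ringInt d 0
  refine ⟨?_, ?_⟩
  · rintro (i | i) (j | j)
    exacts [hU i j, h0, h0, hV i j]
  · have h' : Vᴴ * U = 1 := by
      rw [← Matrix.conjTranspose_conjTranspose U, ← Matrix.conjTranspose_mul, h,
        Matrix.conjTranspose_one]
    simp [J2, Matrix.fromBlocks_conjTranspose, Matrix.fromBlocks_multiply, h, h']

/-- Invariance under unimodular substitutions of determinant one. -/
lemma toFun_unimodular {k : ℤ} (f : HermitianModularForm (-3) k) {U V : Matrix (Fin 2) (Fin 2) ℂ}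
    (hU : ∀ i j, U i j ∈ ringInt (-3)) (hV : ∀ i j, V i j ∈ ringInt (-3)) (h : Uᴴ * V = 1)
    (hdU : U.det = 1) {Z : Matrix (Fin 2) (Fin 2) ℂ} (hZ : Z ∈ HermitianUpperHalfSpace) :
    f.toFun (U * Z * Uᴴ) = f.toFun Z := by
  have hdV : V.det = 1 := by
    have := congrArg Matrix.det h
    simpa [Matrix.det_mul, Matrix.det_conjTranspose, hdU] using this
  have := f.transform _ (fromBlocks_diagonal_mem hU hV h) Z hZ
  simpa [matAct, nuChar, Matrix.inv_eq_left_inv h, hdU, hdV] using this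

/-- The inversion in the upper left variable, as an element of the Hermitian modular group. -/
def partialInversion : Matrix (Fin 2 ⊕ Fin 2) (Fin 2 ⊕ Fin 2) ℂ :=
  Matrix.fromBlocks !![0, 0; 0, 1] !![-1, 0; 0, 0] !![1, 0; 0, 0] !![0, 0; 0, 1]

lemma partialInversion_mem (d : ℤ) : partialInversion ∈ HermitianModularGroup d := by
  have h0 : (0 : ℂ) ∈ ringInt d := by simpa using intCast_mem_ringInt d 0
  have h1 : (1 : ℂ) ∈ ringInt d := by simpa using intCast_mem_ringInt d 1
  have h2 : (-1 : ℂ) ∈ ringInt d := by simpa using intCast_mem_ringInt d (-1)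
  refine ⟨?_, ?_⟩
  · rintro (i | i) (j | j) <;> fin_cases i <;> fin_cases j <;> first | exact h0 | exact h1 | exact h2
  · rw [partialInversion, J2, Matrix.fromBlocks_conjTranspose, Matrix.fromBlocks_multiply,
      Matrix.fromBlocks_multiply]
    congr 1 <;> ext i j <;> fin_cases i <;> fin_cases j <;>
      simp [Matrix.mul_apply, Fin.sum_univ_two]

lemma partialInversion_det_sq : partialInversion.det ^ 2 = 1 := by
  have h : partialInversionᵀ * partialInversion = 1 := by
    rw [partialInversion, Matrix.fromBlocks_transpose, Matrix.fromBlocks_multiply,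
      ← Matrix.fromBlocks_one]
    congr 1 <;> ext i j <;> fin_cases i <;> fin_cases j <;>
      simp [Matrix.mul_apply, Fin.sum_univ_two]
  have := congrArg Matrix.det h
  rwa [Matrix.det_mul, Matrix.det_transpose, Matrix.det_one, ← sq] at this

variable {k : ℤ} (f : HermitianModularForm (-3) k)

lemma toFun_translate {τ z₁ z₂ τ' : ℂ} (h : HexDomain τ z₁ z₂ τ') (x y : ℤ) :
    f.toFun (hexPoint τ (z₁ + x * τ) (z₂ + y * τ)
      (τ' + (x ^ 2 + x * y + y ^ 2) * τ + (2 * x + y) * z₁ + (x + 2 * y) * z₂)) =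
      f.toFun (hexPoint τ z₁ z₂ τ') := by
  have hm0 : (0 : ℂ) ∈ ringInt (-3) := by simpa using intCast_mem_ringInt (-3) 0
  have hm1 : (1 : ℂ) ∈ ringInt (-3) := by simpa using intCast_mem_ringInt (-3) 1
  have hst : star (x + y * (1 - hexRoot) : ℂ) = x + y * hexRoot := by
    simp [← star_hexRoot]
  have hρ : (x + y * (1 - hexRoot) : ℂ) ∈ ringInt (-3) := by
    convert add_mul_hexRoot_mem_ringInt (x + y) (-y) using 1
    push_cast
    ring
  have hρ' : (-(x + y * hexRoot) : ℂ) ∈ ringInt (-3) := by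
    convert add_mul_hexRoot_mem_ringInt (-x) (-y) using 1
    push_cast
    ring
  have hU : (!![1, 0; (x + y * (1 - hexRoot) : ℂ), 1])ᴴ = !![1, x + y * hexRoot; 0, 1] := by
    ext i j
    fin_cases i <;> fin_cases j
    · simp
    · exact hst
    · simp
    · simp
  rw [← f.toFun_unimodular (U := !![1, 0; x + y * (1 - hexRoot), 1])
    (V := !![1, -(x + y * hexRoot); 0, 1]) ?_ ?_ ?_ ?_ (hexPoint_mem h), hU]
  · congr 1
    ext i j
    fin_cases i <;> fin_cases j <;>
      simp only [hexPoint, Matrix.mul_apply, Fin.sum_univ_two, Matrix.of_apply, Matrix.cons_val',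
        Matrix.cons_val_zero, Matrix.cons_val_one, Matrix.cons_val_fin_one, Fin.zero_eta, Fin.mk_one]
    · ring
    · ring
    · ring
    · linear_combination (2 * y * z₂ + y ^ 2 * τ) * hexRoot_sq
  · intro i j
    fin_cases i <;> fin_cases j
    exacts [hm1, hm0, hρ, hm1]
  · intro i j
    fin_cases i <;> fin_cases j
    exacts [hm1, hρ', hm0, hm1]
  · rw [hU]
    ext i j
    fin_cases i <;> fin_cases j <;> simp [Matrix.mul_apply, Fin.sum_univ_two]
  · simp [Matrix.det_fin_two]

lemma toFun_swap {τ z₁ z₂ τ' : ℂ} (h : HexDomain τ z₁ z₂ τ') :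
    f.toFun (hexPoint τ' (-(z₁ + z₂)) z₂ τ) = f.toFun (hexPoint τ z₁ z₂ τ') := by
  have hm0 : (0 : ℂ) ∈ ringInt (-3) := by simpa using intCast_mem_ringInt (-3) 0
  have hm1 : (1 : ℂ) ∈ ringInt (-3) := by simpa using intCast_mem_ringInt (-3) 1
  have hm2 : (-1 : ℂ) ∈ ringInt (-3) := by simpa using intCast_mem_ringInt (-3) (-1)
  have hmem : ∀ i j, (!![0, 1; -1, 0] : Matrix (Fin 2) (Fin 2) ℂ) i j ∈ ringInt (-3) := by
    intro i j
    fin_cases i <;> fin_cases j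
    exacts [hm0, hm1, hm2, hm0]
  rw [← f.toFun_unimodular hmem hmem ?_ (by simp [Matrix.det_fin_two]) (hexPoint_mem h)]
  · congr 1
    ext i j
    fin_cases i <;> fin_cases j <;>
      simp [hexPoint, Matrix.mul_apply, Fin.sum_univ_two]
    all_goals ring
  · ext i j
    fin_cases i <;> fin_cases j <;> simp [Matrix.mul_apply, Fin.sum_univ_two]

lemma toFun_inversion (hk : Even k) {τ z₁ z₂ τ' : ℂ} (h : HexDomain τ z₁ z₂ τ') :
    f.toFun (hexPoint (-1 / τ) (z₁ / τ) (z₂ / τ) (τ' - (z₁ ^ 2 + z₁ * z₂ + z₂ ^ 2) / τ)) =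
      τ ^ k * f.toFun (hexPoint τ z₁ z₂ τ') := by
  have hτ : τ ≠ 0 := fun h0 => by
    have := h.1
    rw [h0] at this
    simp at this
  have key := f.transform _ (partialInversion_mem (-3)) _ (hexPoint_mem h)
  have hden : (!![1, 0; 0, 0] : Matrix (Fin 2) (Fin 2) ℂ) * hexPoint τ z₁ z₂ τ' + !![0, 0; 0, 1] =
      !![τ, z₁ + z₂ * hexRoot; 0, 1] := by
    ext i j
    fin_cases i <;> fin_cases j <;> simp [hexPoint]
  have hinv : (!![τ, z₁ + z₂ * hexRoot; 0, 1] : Matrix (Fin 2) (Fin 2) ℂ)⁻¹ =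
      !![1 / τ, -((z₁ + z₂ * hexRoot) / τ); 0, 1] := by
    refine Matrix.inv_eq_left_inv ?_
    ext i j
    fin_cases i <;> fin_cases j <;> simp [Matrix.mul_apply, Fin.sum_univ_two, hτ]
    all_goals ring
  have hnu : nuChar (-3) k partialInversion = 1 := by
    obtain ⟨j, rfl⟩ := hk.exists_two_nsmul
    rw [nuChar, if_neg (by norm_num), nsmul_eq_mul, Nat.cast_ofNat, _root_.zpow_mul, zpow_ofNat,
      partialInversion_det_sq, _root_.one_zpow]
  rw [hnu, one_mul, matAct] at key
  simp only [partialInversion, Matrix.toBlocks_fromBlocks₁₁, Matrix.toBlocks_fromBlocks₁₂,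
    Matrix.toBlocks_fromBlocks₂₁, Matrix.toBlocks_fromBlocks₂₂] at key
  rw [hden, hinv, Matrix.det_fin_two_of, mul_one, mul_zero, sub_zero] at key
  rw [← key]
  congr 1
  ext i j
  fin_cases i <;> fin_cases j <;>
    simp only [hexPoint, Matrix.mul_apply, Matrix.add_apply, Fin.sum_univ_two, Matrix.of_apply,
      Matrix.cons_val', Matrix.cons_val_zero, Matrix.cons_val_one, Matrix.cons_val_fin_one,
      Fin.zero_eta, Fin.mk_one]
  · ring
  · ring
  · ring
  · linear_combination (-z₂ ^ 2 / τ) * hexRoot_sq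

/-- A Hermitian modular form over `ℚ(√-3)` of even weight in hexagonal coordinates. -/
lemma isHexagonalForm (hk : Even k) :
    IsHexagonalForm k (fun n A B m => f.coeff (hexMatrix (n, A, B, m)))
      (fun τ z₁ z₂ τ' => f.toFun (hexPoint τ z₁ z₂ τ')) where
  support n A B m hne := hexMatrix_posSemidef (f.coeff_supported _ hne).2
  expansion τ z₁ z₂ τ' h := by
    have h1 := f.expansion _ (hexPoint_mem h)
    have h2 := (hasSum_subtype_iff_of_support_subset (f := fun H => f.coeff H * Complex.exp
      (2 * Real.pi * Complex.I * (H * hexPoint τ z₁ z₂ τ').trace)) fun H hH =>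
        f.coeff_supported H (left_ne_zero_of_mul hH)).mp h1
    rw [← hexMatrix_injective.hasSum_iff fun H hH => ?_] at h2
    · refine HasSum.of_term_eq h2 fun p => ?_
      simp only [Function.comp_apply, trace_hexMatrix_mul_hexPoint, expTwoPi]
    · by_contra hne
      obtain ⟨p, hp⟩ := exists_eq_hexMatrix (f.coeff_supported H (left_ne_zero_of_mul hne))
      exact hH ⟨p, hp.symm⟩
  translate τ z₁ z₂ τ' h x y := f.toFun_translate h x y
  swap τ z₁ z₂ τ' h := f.toFun_swap h
  inversion τ z₁ z₂ τ' h := f.toFun_inversion hk h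

end HermitianModularForm

end HermitianTransformations

/-- **Sturm-type congruence criterion for Hermitian modular forms over ℚ(√-3)**
(Theorem 1.1, case `K = ℚ(√-3)`, `d_K = -3`). If a symmetric Hermitian modular
form of even weight `k` with `p`-integral Fourier coefficients has
`a_f([[m, α], [ᾱ, n]]) ≡ 0 (mod p)` for all `0 ≤ m ≤ (5k+9)/45`,
`0 ≤ n ≤ (10k+3)/90`, `α ∈ D_K⁻¹` with `mn - N(α) ≥ 0`, then all its Fourier
coefficients are `≡ 0 (mod p)`. -/
theorem congruence_criterion_sqrt_neg_three
    (p : ℕ) (hp : Nat.Prime p) (hp5 : 5 ≤ p) (k : ℤ) (hk : Even k)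
    (f : HermitianModularForm (-3) k) (hsym : IsSymmetricHMF f)
    (hint : ∀ H, IsPIntegral p (f.coeff H))
    (hcong : ∀ (m n : ℤ) (α : ℂ), α ∈ invDiff (-3) →
      0 ≤ m → 45 * m ≤ 5 * k + 9 → 0 ≤ n → 90 * n ≤ 10 * k + 3 →
      Complex.normSq α ≤ (m : ℝ) * (n : ℝ) →
      ModCongr p 1 (f.coeff !![(m : ℂ), α; (starRingEnd ℂ) α, (n : ℂ)]) 0) :
    ∀ H ∈ HermLattice (-3), ModCongr p 1 (f.coeff H) 0 := by
  intro H hH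
  obtain ⟨⟨n, A, B, m⟩, rfl⟩ := exists_eq_hexMatrix hH
  obtain ⟨O, hv⟩ := exists_valuationSubring_natCast_lt_one hp
  have hform := f.isHexagonalForm hk
  have hprime : ∀ ℓ : ℕ, ℓ.Prime → ℓ ≠ p → O.valuation (ℓ : ℂ) = 1 := fun ℓ hℓ hne => by
    have := valuation_intCast_eq_one hp hv (b := ℓ) fun hd =>
      hne ((Nat.prime_dvd_prime_iff_eq hp hℓ).mp (Int.natCast_dvd_natCast.mp hd)).symm
    simpa using this
  have h6 : O.valuation 1728 = 1 := by
    have h2 := hprime 2 Nat.prime_two (by omega)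
    have h3 := hprime 3 Nat.prime_three (by omega)
    have h1728 : (1728 : ℂ) = ((2 : ℕ) : ℂ) ^ 6 * ((3 : ℕ) : ℂ) ^ 3 := by norm_num
    rw [h1728, map_mul, map_pow, map_pow, h2, h3]
    simp
  refine (hint _).modCongr_zero hp hv (hform.isHexagonalExpansion.valuation_lt_one
    (fun m s hm => ⟨_, hform.isJacobiForm hm s⟩) O h6 hprime
    (fun n A B m => (hint _).valuation_le_one hp hv) (fun n A B m hn hm hnk hmk => ?_) n A B m)
  by_cases hle : A ^ 2 - A * B + B ^ 2 ≤ 3 * (n * m)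
  · refine ModCongr.valuation_lt_one hp hv (hcong n m _ (hexElement_mem_invDiff A B) hn
      (by linarith) hm (by linarith) ?_)
    rw [normSq_hexElement]
    have : ((A : ℝ) ^ 2 - A * B + B ^ 2) ≤ 3 * (n * m) := by exact_mod_cast hle
    linarith
  · have hzero : f.coeff (hexMatrix (n, A, B, m)) = 0 := by
      by_contra hne
      exact hle (hform.support n A B m hne).2.2
    simp [hzero]

end
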